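/- arXiv:1710.07888 — 9 statements merged into one kernel-verified Lean document; each statement's English description precedes it below -/
import Mathlib

section
/- Let v,k,r,λ,μ be positive integers with r ≥ 2 and let C_1,…,C_r be auxiliary matrices with parameters (v,k,r,λ,μ) such that none of C_1,…,C_r equals the all-ones matrix J_v. Then each C_i is symmetric with all diagonal entries equal to 1 and satisfies C_i·J_v = J_v·C_i = k·J_v, and the parameter identities r·k = r − λ + λ·v, k² = μ·v, k + λ = r, and k·λ = (r−1)·μ hold. -/
open Matrix

/-- The all-ones matrix. -/
def matJ (α : Type*) : Matrix α α ℝ := Matrix.of fun _ _ => 1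

/-- A (0,1)-matrix. -/
def Is01 {α β : Type*} (A : Matrix α β ℝ) : Prop := ∀ i j, A i j = 0 ∨ A i j = 1

/-- `C 1, …, C r` are auxiliary matrices with parameters `(v,k,r,lam,mu)`. -/
def IsAuxiliary {v r : ℕ} (C : Fin r → Matrix (Fin v) (Fin v) ℝ)
    (k lam mu : ℕ) : Prop :=
  (∀ i, Is01 (C i)) ∧
  (∑ i, C i) = ((r : ℝ) - (lam : ℝ)) • (1 : Matrix (Fin v) (Fin v) ℝ)
      + (lam : ℝ) • matJ (Fin v) ∧
  (∀ i, C i * (C i)ᵀ = (k : ℝ) • C i) ∧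
  (∀ i j, i ≠ j → C i * (C j)ᵀ = (mu : ℝ) • matJ (Fin v))

theorem stmt0 (v k r lam mu : ℕ) (hv : 0 < v) (hk : 0 < k) (hr : 2 ≤ r)
    (hlam : 0 < lam) (hmu : 0 < mu)
    (C : Fin r → Matrix (Fin v) (Fin v) ℝ)
    (hC : IsAuxiliary C k lam mu)
    (hJ : ∀ i, C i ≠ matJ (Fin v)) :
    (∀ i, (C i)ᵀ = C i) ∧
    (∀ i x, C i x x = 1) ∧
    (∀ i, C i * matJ (Fin v) = (k : ℝ) • matJ (Fin v)) ∧
    (∀ i, matJ (Fin v) * C i = (k : ℝ) • matJ (Fin v)) ∧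
    (r : ℤ) * (k : ℤ) = (r : ℤ) - (lam : ℤ) + (lam : ℤ) * (v : ℤ) ∧
    (k : ℤ) ^ 2 = (mu : ℤ) * (v : ℤ) ∧
    (k : ℤ) + (lam : ℤ) = (r : ℤ) ∧
    (k : ℤ) * (lam : ℤ) = ((r : ℤ) - 1) * (mu : ℤ) := by
  obtain ⟨h01, hsum, hsq, hprod⟩ := hC
  have hk0 : (k : ℝ) ≠ 0 := by exact_mod_cast hk.ne'
  have hmu0 : (mu : ℝ) ≠ 0 := by exact_mod_cast hmu.ne'
  have hsym : ∀ i, (C i)ᵀ = C i := by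
    intro i
    have h1 : ((C i) * (C i)ᵀ)ᵀ = (C i) * (C i)ᵀ := by
      rw [Matrix.transpose_mul, Matrix.transpose_transpose]
    rw [hsq i, Matrix.transpose_smul] at h1
    exact smul_right_injective _ hk0 h1
  have hrowk : ∀ i x, ∑ y, C i x y = k * C i x x := by
    intro i x
    have h1 := congrFun (congrFun (hsq i) x) x
    rw [Matrix.mul_apply, Matrix.smul_apply, smul_eq_mul] at h1
    rw [← h1]
    refine Finset.sum_congr rfl fun y _ => ?_
    rw [Matrix.transpose_apply]
    rcases h01 i x y with h | h <;> rw [h] <;> norm_num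
  have hother : ∀ i : Fin r, ∃ j, i ≠ j := by
    intro i
    have : Nontrivial (Fin r) := Fin.nontrivial_iff_two_le.mpr hr
    obtain ⟨j, hj⟩ := exists_ne i
    exact ⟨j, hj.symm⟩
  have hdiag : ∀ i x, C i x x = 1 := by
    intro i x
    rcases h01 i x x with h | h
    · exfalso
      have h0 : ∑ y, C i x y = 0 := by rw [hrowk, h, mul_zero]
      have hnn : ∀ y ∈ Finset.univ, 0 ≤ C i x y := by
        intro y _
        rcases h01 i x y with h | h <;> rw [h]
        norm_num
      have hz := (Finset.sum_eq_zero_iff_of_nonneg hnn).mp h0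
      obtain ⟨j, hj⟩ := hother i
      have h1 := congrFun (congrFun (hprod i j hj) x) x
      rw [Matrix.mul_apply, Matrix.smul_apply, smul_eq_mul,
        Finset.sum_eq_zero (fun y hy => by rw [hz y hy, zero_mul])] at h1
      simp only [matJ, Matrix.of_apply, mul_one] at h1
      exact hmu0 h1.symm
    · exact h
  have hrow : ∀ i x, ∑ y, C i x y = k := by
    intro i x
    rw [hrowk, hdiag, mul_one]
  have hCJ : ∀ i, C i * matJ (Fin v) = (k : ℝ) • matJ (Fin v) := by
    intro i
    ext x y
    simp [Matrix.mul_apply, matJ, hrow]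
  have hJT : (matJ (Fin v))ᵀ = matJ (Fin v) := by
    ext x y
    simp [matJ]
  have hJC : ∀ i, matJ (Fin v) * C i = (k : ℝ) • matJ (Fin v) := by
    intro i
    have h1 := congrArg Matrix.transpose (hCJ i)
    rwa [Matrix.transpose_mul, Matrix.transpose_smul, hJT, hsym] at h1
  let x0 : Fin v := ⟨0, hv⟩
  let i0 : Fin r := ⟨0, by omega⟩
  have e1 : (r : ℝ) * k = r - lam + lam * v := by
    have h1 := congrArg (fun M : Matrix (Fin v) (Fin v) ℝ => M * matJ (Fin v)) hsum
    simp only [Finset.sum_mul, hCJ, add_mul, Matrix.smul_mul, one_mul] at h1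

    replace h1 := congrFun (congrFun h1 x0) x0
    simpa [matJ, Matrix.mul_apply] using h1
  have e2 : (k : ℝ) ^ 2 = mu * v := by
    obtain ⟨j, hj⟩ := hother i0
    have h1 := congrArg (fun M : Matrix (Fin v) (Fin v) ℝ => M * matJ (Fin v)) (hprod i0 j hj)
    simp only [hsym, Matrix.mul_assoc, hCJ, Matrix.mul_smul, Matrix.smul_mul] at h1

    replace h1 := congrFun (congrFun h1 x0) x0
    simp [matJ, Matrix.mul_apply] at h1
    rw [← h1, sq]
  have key : ∀ x y, (k : ℝ) * C i0 x y + (r - 1) * mu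
      = (r - lam) * C i0 x y + lam * k := by
    intro x y
    have h1 := congrArg (fun M : Matrix (Fin v) (Fin v) ℝ => M * C i0) hsum
    simp only [Finset.sum_mul, add_mul, Matrix.smul_mul, one_mul, hJC] at h1

    replace h1 := congrFun (congrFun h1 x) y
    rw [Matrix.sum_apply, Matrix.add_apply] at h1
    have h2 : ∀ j, (C j * C i0) x y = mu + if j = i0 then k * C i0 x y - mu else 0 := by
      intro j
      split_ifs with hji
      · rw [hji]
        have h3 := hsq i0
        rw [hsym] at h3
        rw [h3]
        simp
      · have h3 := hprod j i0 hji
        rw [hsym] at h3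
        rw [h3]
        simp [matJ]
    simp only [h2, Finset.sum_add_distrib, Finset.sum_ite_eq', Finset.mem_univ, if_true] at h1
    simp [matJ] at h1
    linarith
  have hzero : ∃ x y, C i0 x y = 0 := by
    by_contra hcon
    push Not at hcon
    apply hJ i0
    ext x y
    simpa [matJ] using (h01 i0 x y).resolve_left (hcon x y)
  have e4 : (k : ℝ) * lam = (r - 1) * mu := by
    obtain ⟨x, y, hxy⟩ := hzero
    have := key x y
    rw [hxy] at this
    linarith
  have e3 : (k : ℝ) + lam = r := by
    have := key x0 x0
    rw [hdiag] at this
    linarith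
  refine ⟨hsym, hdiag, hCJ, hJC, ?_, ?_, ?_, ?_⟩
  · exact_mod_cast e1
  · exact_mod_cast e2
  · exact_mod_cast e3
  · exact_mod_cast e4
end

section
/- Let n ≥ 4 and let H be an n×n real matrix with all entries ±1 such that H·Hᵀ = n·I_n and such that the row of H indexed by 0 is the all-ones row. Denote the rows of H by r_0, r_1, …, r_{n−1} and for i = 1,…,n−1 define the n×n matrix C_i = (r_iᵀ·r_i + J_n)/2. Then each C_i is a symmetric (0,1)-matrix, ∑_{i=1}^{n−1} C_i = (n/2)·I_n + ((n−2)/2)·J_n, C_i·C_iᵀ = (n/2)·C_i for every i, and C_i·C_jᵀ = (n/4)·J_n for all distinct i,j. -/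
open Matrix

theorem stmt1 (n : ℕ) (hn : 4 ≤ n) (H : Matrix (Fin n) (Fin n) ℝ)
    (hpm : ∀ i j, H i j = 1 ∨ H i j = -1)
    (hHad : H * Hᵀ = (n : ℝ) • (1 : Matrix (Fin n) (Fin n) ℝ))
    (hrow0 : ∀ j, H ⟨0, by omega⟩ j = 1)
    (C : Fin n → Matrix (Fin n) (Fin n) ℝ)
    (hC : ∀ i, C i = Matrix.of fun x y => (H i x * H i y + 1) / 2) :
    (∀ i : Fin n, i ≠ ⟨0, by omega⟩ → (C i)ᵀ = C i ∧ Is01 (C i)) ∧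
    (∑ i ∈ Finset.univ.erase (⟨0, by omega⟩ : Fin n), C i)
      = ((n : ℝ) / 2) • (1 : Matrix (Fin n) (Fin n) ℝ)
        + (((n : ℝ) - 2) / 2) • matJ (Fin n) ∧
    (∀ i : Fin n, i ≠ ⟨0, by omega⟩ → C i * (C i)ᵀ = ((n : ℝ) / 2) • C i) ∧
    (∀ i j : Fin n, i ≠ ⟨0, by omega⟩ → j ≠ ⟨0, by omega⟩ → i ≠ j →
      C i * (C j)ᵀ = ((n : ℝ) / 4) • matJ (Fin n)) := by
  have hn0 : (n : ℝ) ≠ 0 := by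
    have : n ≠ 0 := by omega
    exact_mod_cast this
  have hrow : ∀ i j, ∑ z, H i z * H j z = if i = j then (n : ℝ) else 0 := by
    intro i j
    have h := congrFun (congrFun hHad i) j
    simpa [Matrix.mul_apply, Matrix.one_apply] using h
  have hHad2 : Hᵀ * H = (n : ℝ) • (1 : Matrix (Fin n) (Fin n) ℝ) := by
    have h1 : H * ((n : ℝ)⁻¹ • Hᵀ) = 1 := by
      rw [Matrix.mul_smul, hHad, smul_smul, inv_mul_cancel₀ hn0, one_smul]
    have h2 := mul_eq_one_comm.mp h1
    rw [Matrix.smul_mul] at h2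
    rw [← h2, smul_smul, mul_inv_cancel₀ hn0, one_smul]
  have hcol : ∀ x y, ∑ i, H i x * H i y = if x = y then (n : ℝ) else 0 := by
    intro x y
    have h := congrFun (congrFun hHad2 x) y
    simpa [Matrix.mul_apply, Matrix.one_apply] using h
  have hS : ∀ i : Fin n, i ≠ ⟨0, by omega⟩ → ∑ z, H i z = 0 := by
    intro i hi
    have h := hrow i ⟨0, by omega⟩
    rw [if_neg hi] at h
    simpa [hrow0] using h
  have key : ∀ i j : Fin n, i ≠ ⟨0, by omega⟩ → j ≠ ⟨0, by omega⟩ → ∀ x y,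
      (C i * (C j)ᵀ) x y = (H i x * H j y * (if i = j then (n : ℝ) else 0) + n) / 4 := by
    intro i j hi hj x y
    have e : (C i * (C j)ᵀ) x y = ∑ z, (H i x * H j y / 4 * (H i z * H j z)
        + H i x / 4 * H i z + H j y / 4 * H j z + 1 / 4) := by
      rw [Matrix.mul_apply]
      refine Finset.sum_congr rfl fun z _ => ?_
      rw [Matrix.transpose_apply, hC, hC, Matrix.of_apply, Matrix.of_apply]
      ring
    rw [e, Finset.sum_add_distrib, Finset.sum_add_distrib, Finset.sum_add_distrib,
      ← Finset.mul_sum, ← Finset.mul_sum, ← Finset.mul_sum, hrow, hS i hi, hS j hj]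
    simp only [Finset.sum_const, Finset.card_univ, Fintype.card_fin, nsmul_eq_mul]
    ring
  refine ⟨fun i _ => ⟨?_, ?_⟩, ?_, ?_, ?_⟩
  · ext x y
    rw [Matrix.transpose_apply, hC, Matrix.of_apply, Matrix.of_apply, mul_comm]
  · intro x y
    rw [hC, Matrix.of_apply]
    rcases hpm i x with h | h <;> rcases hpm i y with h' | h' <;> rw [h, h'] <;> norm_num
  · ext x y
    rw [Matrix.sum_apply]
    have h := Finset.add_sum_erase Finset.univ (fun i => C i x y)
      (Finset.mem_univ (⟨0, by omega⟩ : Fin n))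
    have h2 : ∑ i, C i x y = ((if x = y then (n : ℝ) else 0) + n) / 2 := by
      rw [← hcol]
      simp only [hC, Matrix.of_apply]
      rw [← Finset.sum_div, Finset.sum_add_distrib]
      simp
    have h3 : C ⟨0, by omega⟩ x y = 1 := by
      rw [hC, Matrix.of_apply, hrow0, hrow0]; norm_num
    simp only [h2, h3] at h
    simp only [Matrix.add_apply, Matrix.smul_apply, Matrix.one_apply, matJ, Matrix.of_apply,
      smul_eq_mul]
    split_ifs at h ⊢ <;> linarith
  · intro i hi
    ext x y
    rw [key i i hi hi, if_pos rfl, Matrix.smul_apply, hC, Matrix.of_apply, smul_eq_mul]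
    ring
  · intro i j hi hj hij
    ext x y
    rw [key i j hi hj, if_neg hij, Matrix.smul_apply, matJ, Matrix.of_apply, smul_eq_mul]
    ring
end

section
/- Let L₁ and L₂ be orthogonal Latin squares of size n on a common symbol set S. Define M from {1,…,n}×{1,…,n} to S by M(i,j) = L₁(i,a), where a is the unique index with L₁(i,a) = L₂(j,a). Then M is a Latin square of size n on S. -/
/-- A Latin square of size `n` on a symbol set `S`. -/
def IsLatinSquare {n : ℕ} {S : Type*} (L : Fin n → Fin n → S) : Prop :=
  (∀ i, Function.Bijective (L i)) ∧ (∀ j, Function.Bijective fun i => L i j)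

theorem stmt3 (n : ℕ) (S : Type*) [Fintype S] (hS : Fintype.card S = n)
    (L₁ L₂ : Fin n → Fin n → S)
    (h1 : IsLatinSquare L₁) (h2 : IsLatinSquare L₂)
    (horth : ∀ i j, ∃! a, L₁ i a = L₂ j a)
    (M : Fin n → Fin n → S)
    (hM : ∀ i j a, L₁ i a = L₂ j a → M i j = L₁ i a) :
    IsLatinSquare M := by
  refine ⟨fun i => ⟨fun j j' h => ?_, fun s => ?_⟩, fun j => ⟨fun i i' h => ?_, fun s => ?_⟩⟩
  · obtain ⟨a, ha, -⟩ := horth i j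
    obtain ⟨b, hb, -⟩ := horth i j'
    rw [hM i j a ha, hM i j' b hb] at h
    have hab := (h1.1 i).1 h
    subst hab
    exact (h2.2 a).1 (ha.symm.trans hb)
  · obtain ⟨a, ha⟩ := (h1.1 i).2 s
    obtain ⟨j, hj⟩ := (h2.2 a).2 s
    exact ⟨j, (hM i j a (ha.trans hj.symm)).trans ha⟩
  · obtain ⟨a, ha, -⟩ := horth i j
    obtain ⟨b, hb, -⟩ := horth i' j
    have h' : M i j = M i' j := h
    rw [hM i j a ha, hM i' j b hb] at h'
    have hab : a = b := (h2.1 j).1 (ha.symm.trans (h'.trans hb))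
    subst hab
    exact (h1.2 a).1 h'
  · obtain ⟨a, ha⟩ := (h2.1 j).2 s
    obtain ⟨i, hi⟩ := (h1.2 a).2 s
    have hi' : L₁ i a = s := hi
    exact ⟨i, (hM i j a (hi'.trans ha.symm)).trans hi'⟩
end

section
/- Assume m > 1, n > 1, λ₁ < k < (m−1)·n and f ≥ 3, and let A_{i,j} (i,j ∈ {1,…,f}, i ≠ j) be a linked system of SGDDs of type II with parameters (v,k,m,n,λ₁,λ₂) and (σ,τ,ρ). Then, as integers: (σ−τ)² = k − λ₁; (σ−τ)·(ρ−τ) + (σ−τ+k)·τ = k·λ₂; and (ρ−τ−λ₁+λ₂)·k = (m−1)·(σ−τ)·(ρ−τ). -/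
open Matrix

/-- The block-diagonal matrix `K_{m,n} = I_m ⊗ J_n`. -/
def matK (m n : ℕ) : Matrix (Fin m × Fin n) (Fin m × Fin n) ℝ :=
  Matrix.of fun p q => if p.1 = q.1 then 1 else 0

/-- `A` is a symmetric group divisible design with parameters `(m*n, k, m, n, l1, l2)`. -/
def IsSGDD {m n : ℕ} (A : Matrix (Fin m × Fin n) (Fin m × Fin n) ℝ)
    (k l1 l2 : ℕ) : Prop :=
  Is01 A ∧
  A * Aᵀ = (k : ℝ) • (1 : Matrix (Fin m × Fin n) (Fin m × Fin n) ℝ)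
      + (l1 : ℝ) • (matK m n - 1) + (l2 : ℝ) • (matJ (Fin m × Fin n) - matK m n) ∧
  Aᵀ * A = (k : ℝ) • (1 : Matrix (Fin m × Fin n) (Fin m × Fin n) ℝ)
      + (l1 : ℝ) • (matK m n - 1) + (l2 : ℝ) • (matJ (Fin m × Fin n) - matK m n)

/-- A linked system of symmetric group divisible designs of type II with parameters
`(m*n, k, m, n, l1, l2)` and `(σ, τ, ρ)`. -/
def IsLinkedSGDDII {f m n : ℕ}
    (A : Fin f → Fin f → Matrix (Fin m × Fin n) (Fin m × Fin n) ℝ)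
    (k l1 l2 σ τ ρ : ℕ) : Prop :=
  (∀ i j, i ≠ j → (A i j)ᵀ = A j i) ∧
  (∀ i j, i ≠ j → IsSGDD (A i j) k l1 l2) ∧
  (∀ i j, i ≠ j → Is01 (A i j + matK m n)) ∧
  (∀ i j l, i ≠ j → j ≠ l → i ≠ l →
    A i j * A j l = (σ : ℝ) • A i l
      + (τ : ℝ) • (matJ (Fin m × Fin n) - A i l - matK m n) + (ρ : ℝ) • matK m n)

section helpers
variable {m n : ℕ}

lemma aux_matK_symm (p q : Fin m × Fin n) : matK m n p q = matK m n q p := by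
  simp [matK, eq_comm]

lemma aux_KJ : matK m n * matJ (Fin m × Fin n) = (n : ℝ) • matJ (Fin m × Fin n) := by
  ext p q
  simp only [matK, matJ, Matrix.mul_apply, Matrix.of_apply, Matrix.smul_apply, mul_one,
    Fintype.sum_prod_type_right, Finset.sum_ite_eq, Finset.mem_univ, if_true]
  simp

lemma aux_JJ : matJ (Fin m × Fin n) * matJ (Fin m × Fin n)
    = ((m : ℝ) * n) • matJ (Fin m × Fin n) := by
  ext p q
  simp [matJ, Matrix.mul_apply]

lemma aux_XK_const (X : Matrix (Fin m × Fin n) (Fin m × Fin n) ℝ)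
    (x y y' : Fin m × Fin n) (h : y.1 = y'.1) :
    (X * matK m n) x y = (X * matK m n) x y' := by
  simp [matK, Matrix.mul_apply, h]

lemma aux_diag (X : Matrix (Fin m × Fin n) (Fin m × Fin n) ℝ) (h0 : Is01 X)
    (h : Is01 (X + matK m n)) (p q : Fin m × Fin n) (hpq : p.1 = q.1) : X p q = 0 := by
  have h1 := h0 p q
  have h2 := h p q
  simp only [Matrix.add_apply, matK, Matrix.of_apply, hpq, if_true] at h2
  rcases h1 with h1 | h1
  · exact h1
  · rw [h1] at h2; norm_num at h2

lemma aux_XK_diag (X : Matrix (Fin m × Fin n) (Fin m × Fin n) ℝ) (h0 : Is01 X)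
    (h : Is01 (X + matK m n)) (p : Fin m × Fin n) : (X * matK m n) p p = 0 := by
  rw [Matrix.mul_apply]
  apply Finset.sum_eq_zero
  intro q _
  by_cases hq : p.1 = q.1
  · rw [aux_diag X h0 h p q hq, zero_mul]
  · simp [matK, Ne.symm hq]

lemma aux_rowsum {X : Matrix (Fin m × Fin n) (Fin m × Fin n) ℝ} {k l1 l2 : ℕ}
    (h : IsSGDD X k l1 l2) : X * matJ _ = (k : ℝ) • matJ _ := by
  obtain ⟨h0, h1, -⟩ := h
  ext p q
  have h2 := congrFun (congrFun h1 p) p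
  simp only [Matrix.mul_apply, Matrix.transpose_apply, Matrix.add_apply, Matrix.smul_apply,
    Matrix.sub_apply, matK, matJ, Matrix.of_apply, Matrix.one_apply_eq, if_true, smul_eq_mul,
    sub_self, mul_zero, add_zero, mul_one] at h2 ⊢
  rw [← h2]
  apply Finset.sum_congr rfl
  intro y _
  rcases h0 p y with h | h <;> simp [h]

lemma aux_SGDD_transpose {X : Matrix (Fin m × Fin n) (Fin m × Fin n) ℝ} {k l1 l2 : ℕ}
    (h : IsSGDD X k l1 l2) : IsSGDD Xᵀ k l1 l2 := by
  obtain ⟨h0, h1, h2⟩ := h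
  exact ⟨fun i j => h0 j i, by simpa using h2, by simpa using h1⟩

lemma aux_colsum {X : Matrix (Fin m × Fin n) (Fin m × Fin n) ℝ} {k l1 l2 : ℕ}
    (h : IsSGDD X k l1 l2) : matJ _ * X = (k : ℝ) • matJ _ := by
  have h1 := aux_rowsum (aux_SGDD_transpose h)
  have hJ : (matJ (Fin m × Fin n))ᵀ = matJ _ := by ext; simp [matJ]
  have h2 := congrArg Matrix.transpose h1
  simpa [hJ] using h2

lemma aux_comm {X : Matrix (Fin m × Fin n) (Fin m × Fin n) ℝ} {k l1 l2 : ℕ}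
    (h : IsSGDD X k l1 l2) :
    ((l1 : ℝ) - l2) • (matK m n * X) = ((l1 : ℝ) - l2) • (X * matK m n) := by
  have hr := aux_rowsum h
  have hc := aux_colsum h
  obtain ⟨h0, h1, h2⟩ := h
  have h3 : (X * Xᵀ) * X = X * (Xᵀ * X) := Matrix.mul_assoc _ _ _
  rw [h1, h2] at h3
  simp only [Matrix.add_mul, Matrix.mul_add, Matrix.sub_mul, Matrix.mul_sub, Matrix.smul_mul,
    Matrix.mul_smul, Matrix.one_mul, Matrix.mul_one, hr, hc] at h3
  ext p q
  have h4 := congrFun (congrFun h3 p) q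
  simp only [Matrix.add_apply, Matrix.smul_apply, Matrix.sub_apply, smul_eq_mul] at h4 ⊢
  linarith

lemma aux_key {A B C : Matrix (Fin m × Fin n) (Fin m × Fin n) ℝ} {k l1 l2 σ τ ρ : ℕ}
    (hA : IsSGDD A k l1 l2) (hB : IsSGDD B k l1 l2)
    (hAB : A * B = (σ : ℝ) • C
      + (τ : ℝ) • (matJ (Fin m × Fin n) - C - matK m n) + (ρ : ℝ) • matK m n)
    (hAC : Aᵀ * C = (σ : ℝ) • B
      + (τ : ℝ) • (matJ (Fin m × Fin n) - B - matK m n) + (ρ : ℝ) • matK m n) :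
    ((k : ℝ) - l1 - (σ - τ) ^ 2) • B + ((l1 : ℝ) - l2) • (B * matK m n)
      - ((ρ : ℝ) - τ) • (Aᵀ * matK m n)
    = (((σ : ℝ) - τ) * τ + τ * k - l2 * k) • matJ _
      + (((σ : ℝ) - τ) * (ρ - τ)) • matK m n := by
  have hr := aux_rowsum (aux_SGDD_transpose hA)
  have hc := aux_colsum hB
  have hK := aux_comm hB
  have h3 : (Aᵀ * A) * B = Aᵀ * (A * B) := Matrix.mul_assoc _ _ _
  rw [hA.2.2, hAB] at h3
  simp only [Matrix.add_mul, Matrix.mul_add, Matrix.sub_mul, Matrix.mul_sub, Matrix.smul_mul,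
    Matrix.mul_smul, Matrix.one_mul, Matrix.mul_one, hr, hc, hAC] at h3
  rw [← hK]
  ext p q
  have h4 := congrFun (congrFun h3 p) q
  simp only [Matrix.add_apply, Matrix.smul_apply, Matrix.sub_apply, smul_eq_mul] at h4 ⊢
  linear_combination h4

end helpers

theorem stmt9 (f m n k l1 l2 σ τ ρ : ℕ) (hm : 1 < m) (hn : 1 < n)
    (hk1 : l1 < k) (hk2 : k < (m - 1) * n) (hf : 3 ≤ f)
    (A : Fin f → Fin f → Matrix (Fin m × Fin n) (Fin m × Fin n) ℝ)
    (hA : IsLinkedSGDDII A k l1 l2 σ τ ρ) :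
    ((σ : ℤ) - (τ : ℤ)) ^ 2 = (k : ℤ) - (l1 : ℤ) ∧
    ((σ : ℤ) - τ) * ((ρ : ℤ) - τ) + ((σ : ℤ) - τ + k) * τ = (k : ℤ) * l2 ∧
    ((ρ : ℤ) - τ - l1 + l2) * k = ((m : ℤ) - 1) * (((σ : ℤ) - τ) * ((ρ : ℤ) - τ)) := by
  obtain ⟨hT, hS, h01, hL⟩ := hA
  let i0 : Fin f := ⟨0, by omega⟩
  let i1 : Fin f := ⟨1, by omega⟩
  let i2 : Fin f := ⟨2, by omega⟩
  have n01 : i0 ≠ i1 := by simp [i0, i1]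
  have n02 : i0 ≠ i2 := by simp [i0, i2]
  have n12 : i1 ≠ i2 := by simp [i1, i2]
  have hA := hS i0 i1 n01
  have hAt := aux_SGDD_transpose hA
  have hB := hS i1 i2 n12
  have dA : Is01 ((A i0 i1)ᵀ + matK m n) := by rw [hT _ _ n01]; exact h01 _ _ n01.symm
  have dB := h01 i1 i2 n12
  have hAC := hL i1 i0 i2 n01.symm n02 n12
  rw [← hT _ _ n01] at hAC
  have E := aux_key hA hB (hL i0 i1 i2 n01 n12 n02) hAC
  generalize A i0 i1 = X at *
  generalize A i1 i2 = Y at *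
  let p : Fin m × Fin n := (⟨0, by omega⟩, ⟨0, by omega⟩)
  let q : Fin m × Fin n := (⟨0, by omega⟩, ⟨1, by omega⟩)
  have hpq : p ≠ q := by simp [p, q]
  have hpq1 : p.1 = q.1 := rfl
  -- first equation
  have e1 : (k : ℝ) - l1 - (σ - τ) ^ 2 = 0 := by
    by_contra hne
    have hcol : ∀ x, Y x p = Y x q := by
      intro x
      have hp := congrFun (congrFun E x) p
      have hq := congrFun (congrFun E x) q
      have hKK : matK m n x p = matK m n x q := by simp [matK, hpq1]
      simp only [Matrix.add_apply, Matrix.smul_apply, Matrix.sub_apply, smul_eq_mul] at hp hq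
      rw [aux_XK_const Y x p q hpq1, aux_XK_const Xᵀ x p q hpq1, hKK] at hp
      have hJJ : matJ (Fin m × Fin n) x p = matJ (Fin m × Fin n) x q := rfl
      rw [hJJ] at hp
      exact mul_left_cancel₀ hne (by linarith)
    have g1 := congrFun (congrFun hB.2.2 p) p
    have g2 := congrFun (congrFun hB.2.2 p) q
    have g3 : (Yᵀ * Y) p p = (Yᵀ * Y) p q := by
      simp [Matrix.mul_apply, hcol]
    rw [g1, g2] at g3
    have hkl : (l1 : ℝ) < k := by exact_mod_cast hk1
    simp [matK, matJ, hpq, hpq1] at g3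
    linarith
  -- second equation
  have e2 := congrFun (congrFun E p) p
  simp only [Matrix.add_apply, Matrix.smul_apply, Matrix.sub_apply, smul_eq_mul] at e2
  rw [aux_XK_diag Y hB.1 dB p, aux_XK_diag Xᵀ hAt.1 dA p, e1] at e2
  have hKp : matK m n p p = 1 := by simp [matK]
  have hJp : matJ (Fin m × Fin n) p p = 1 := rfl
  rw [hKp, hJp] at e2
  -- third equation
  have e3 := congrFun (congrFun (congrArg
    (fun M : Matrix (Fin m × Fin n) (Fin m × Fin n) ℝ => M * matJ (Fin m × Fin n)) E) p) p
  simp only [Matrix.add_mul, Matrix.sub_mul, Matrix.smul_mul, Matrix.mul_assoc, aux_KJ, aux_JJ,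
    Matrix.mul_smul, aux_rowsum hB, aux_rowsum hAt, Matrix.add_apply, Matrix.smul_apply,
    Matrix.sub_apply, smul_eq_mul, hJp, e1] at e3
  have hn0 : (n : ℝ) ≠ 0 := by
    have : n ≠ 0 := by omega
    exact_mod_cast this
  have e3' : ((ρ : ℝ) - τ - l1 + l2) * k = ((m : ℝ) - 1) * (((σ : ℝ) - τ) * ((ρ : ℝ) - τ)) := by
    apply mul_left_cancel₀ hn0
    linear_combination -e3 + (m : ℝ) * n * e2
  have e1' : ((σ : ℝ) - τ) ^ 2 = k - l1 := by linarith
  have e2' : ((σ : ℝ) - τ) * ((ρ : ℝ) - τ) + ((σ : ℝ) - τ + k) * τ = (k : ℝ) * l2 := by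
    linarith
  exact ⟨by exact_mod_cast e1', by exact_mod_cast e2', by exact_mod_cast e3'⟩
end

section
/- Assume m > 1, n > 1, λ₁ < k < (m−1)·n and f ≥ 3. If there exists a linked system of SGDDs of type II A_{i,j} (i,j ∈ {1,…,f}, i ≠ j) with parameters (v,k,m,n,λ₁,λ₂) and (σ,τ,ρ), then f ≤ m. -/
open Matrix

lemma aux_proj {V ι : Type*} [Fintype V] [DecidableEq V] [Fintype ι] [DecidableEq ι]
    (D S : Matrix V V ℝ) (B : ι → Matrix V V ℝ) (c : ℝ) (hc : 0 < c)
    (hDt : Dᵀ = D) (hDD : D * D = D) (hSt : Sᵀ = S) (hSS : S * S = S)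
    (hSB : ∀ i, S * B i * D = 0)
    (hBB : ∀ i j, D * ((B i)ᵀ * B j) * D = if i = j then c • D else 0) :
    (Fintype.card ι : ℝ) * D.trace + S.trace ≤ Fintype.card V := by
  set T : Matrix V V ℝ := ∑ i, B i * D * (B i)ᵀ with hT
  have hTt : Tᵀ = T := by
    rw [hT, Matrix.transpose_sum]
    refine Finset.sum_congr rfl fun i _ => ?_
    simp [Matrix.transpose_mul, hDt, Matrix.mul_assoc]
  have hTT : T * T = c • T := by
    conv_lhs => rw [hT]
    rw [Finset.sum_mul]
    conv_rhs => rw [hT]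
    rw [Finset.smul_sum]
    refine Finset.sum_congr rfl fun i _ => ?_
    rw [Finset.mul_sum]
    have h1 : ∀ j, B i * D * (B i)ᵀ * (B j * D * (B j)ᵀ)
        = if i = j then c • (B i * D * (B i)ᵀ) else 0 := by
      intro j
      have : B i * D * (B i)ᵀ * (B j * D * (B j)ᵀ)
        = B i * (D * ((B i)ᵀ * B j) * D) * (B j)ᵀ := by simp only [Matrix.mul_assoc]
      rw [this, hBB]
      split_ifs with h
      · subst h; simp
      · simp
    simp [h1]
  have hST : S * T = 0 := by
    rw [hT, Finset.mul_sum]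
    refine Finset.sum_eq_zero fun i _ => ?_
    rw [← Matrix.mul_assoc, ← Matrix.mul_assoc, hSB]; simp
  have hTS : T * S = 0 := by
    have := congrArg Matrix.transpose hST
    simpa [Matrix.transpose_mul, hTt, hSt] using this
  have htr : T.trace = Fintype.card ι * (c * D.trace) := by
    rw [hT, Matrix.trace_sum]
    have : ∀ i, (B i * D * (B i)ᵀ).trace = c * D.trace := by
      intro i
      have h := congrArg Matrix.trace (hBB i i)
      rw [Matrix.trace_mul_comm, ← Matrix.mul_assoc, hDD] at h
      rw [Matrix.trace_mul_comm, ← Matrix.mul_assoc, Matrix.trace_mul_comm, h]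
      simp
    simp [this]
  set R : Matrix V V ℝ := 1 - S - c⁻¹ • T with hR
  have hRR : Rᵀ * R = R := by
    have : Rᵀ = R := by simp [hR, hTt, hSt]
    rw [this, hR]
    simp only [sub_mul, mul_sub, Matrix.smul_mul, Matrix.mul_smul, hSS, hST, hTS, hTT,
      Matrix.one_mul, Matrix.mul_one, smul_smul]
    rw [inv_mul_cancel₀ hc.ne']
    simp
  have h0 : 0 ≤ R.trace := by
    rw [← hRR, Matrix.trace]
    refine Finset.sum_nonneg fun p _ => ?_
    simp only [Matrix.diag_apply, Matrix.mul_apply, Matrix.transpose_apply]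
    exact Finset.sum_nonneg fun q _ => mul_self_nonneg _
  have h1 : R.trace = Fintype.card V - S.trace - Fintype.card ι * D.trace := by
    rw [hR, Matrix.trace_sub, Matrix.trace_sub, Matrix.trace_smul, htr, Matrix.trace_one]
    simp only [smul_eq_mul]
    field_simp
  linarith

/-- projection on the sum-zero vectors of the group `a`. -/
noncomputable def matD (m n : ℕ) (a : Fin m) : Matrix (Fin m × Fin n) (Fin m × Fin n) ℝ :=
  Matrix.of fun p q => if p.1 = a ∧ q.1 = a then ((if p.2 = q.2 then 1 else 0) - (n : ℝ)⁻¹) else 0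

lemma matD_t (m n : ℕ) (a : Fin m) : (matD m n a)ᵀ = matD m n a := by
  ext p q
  simp only [matD, Matrix.transpose_apply, Matrix.of_apply, and_comm, eq_comm]

lemma matD_row (m n : ℕ) (hn : 1 < n) (a : Fin m) (p) : ∑ q, matD m n a p q = 0 := by
  have : (n : ℝ) ≠ 0 := by positivity
  simp only [matD, Matrix.of_apply, Fintype.sum_prod_type]
  by_cases h : p.1 = a
  · simp only [h, true_and]
    rw [Finset.sum_eq_single a]
    · simp [this]
    · intro b _ hb; simp [hb]
    · simp
  · simp [h]

lemma matD_col (m n : ℕ) (hn : 1 < n) (a : Fin m) (q) : ∑ p, matD m n a p q = 0 := by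
  rw [← matD_row m n hn a q]
  refine Finset.sum_congr rfl fun p _ => ?_
  rw [← Matrix.transpose_apply (matD m n a), matD_t]

lemma matD_const (m n : ℕ) (hn : 1 < n) (a : Fin m) (X : Matrix (Fin m × Fin n) (Fin m × Fin n) ℝ)
    (t : ℝ) (hX : ∀ p q, p.1 = a → q.1 = a → X p q = t) : matD m n a * X * matD m n a = 0 := by
  ext p q
  simp only [Matrix.mul_apply, Matrix.zero_apply, Finset.sum_mul]
  have : ∀ s r, matD m n a p r * X r s * matD m n a s q
      = t * (matD m n a p r * matD m n a s q) := by
    intro s r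
    by_cases h1 : r.1 = a
    · by_cases h2 : s.1 = a
      · rw [hX r s h1 h2]; ring
      · simp [matD, h2]
    · simp [matD, h1]
  simp only [this, ← Finset.mul_sum, ← Finset.sum_mul, matD_row m n hn]
  simp

lemma matK_matD (m n : ℕ) (hn : 1 < n) (a : Fin m) : matK m n * matD m n a = 0 := by
  ext p q
  simp only [Matrix.mul_apply, Matrix.zero_apply]
  by_cases h : p.1 = a
  · rw [← matD_col m n hn a q]
    refine Finset.sum_congr rfl fun r _ => ?_
    by_cases h1 : r.1 = a
    · simp [matK, h, h1]
    · simp [matD, h1]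
  · refine Finset.sum_eq_zero fun r _ => ?_
    by_cases h1 : r.1 = a
    · simp [matK, h, h1]
    · simp [matD, h1]

lemma matD_sq (m n : ℕ) (hn : 1 < n) (a : Fin m) : matD m n a * matD m n a = matD m n a := by
  ext p q
  have hh : ∀ r, matD m n a p r * matD m n a r q
      = (if r = p then matD m n a p q else 0) -
        (if p.1 = a then (n : ℝ)⁻¹ else 0) * matD m n a r q := by
    rintro ⟨r1, r2⟩
    obtain ⟨p1, p2⟩ := p
    obtain ⟨q1, q2⟩ := q
    simp only [matD, Matrix.of_apply, Prod.mk.injEq]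
    by_cases h1 : p1 = a <;> by_cases h2 : q1 = a <;> by_cases h3 : r1 = a <;>
      by_cases h4 : p2 = r2 <;> simp_all [eq_comm] <;> grind
  rw [Matrix.mul_apply]
  simp only [hh, Finset.sum_sub_distrib, ← Finset.mul_sum, matD_col m n hn]
  simp

lemma matD_trace (m n : ℕ) (hn : 1 < n) (a : Fin m) : (matD m n a).trace = n - 1 := by
  have : (n : ℝ) ≠ 0 := by positivity
  simp only [matD, Matrix.trace, Matrix.diag_apply, Matrix.of_apply, Fintype.sum_prod_type]
  rw [Finset.sum_eq_single a]
  · simp [mul_sub, this]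
  · intro b _ hb; simp [hb]
  · simp

lemma matK_t (m n : ℕ) : (matK m n)ᵀ = matK m n := by
  ext p q; simp [matK, eq_comm]

lemma matJ_t (α : Type*) : (matJ α)ᵀ = matJ α := by
  ext p q; simp [matJ]

lemma matK_sq (m n : ℕ) : matK m n * matK m n = (n : ℝ) • matK m n := by
  ext p q
  simp only [matK, Matrix.mul_apply, Matrix.of_apply, Fintype.sum_prod_type, Matrix.smul_apply]
  rw [Finset.sum_eq_single p.1]
  · simp
  · intro b _ hb; simp [hb.symm]
  · simp

lemma matK_trace (m n : ℕ) : (matK m n).trace = m * n := by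
  simp [matK, Matrix.trace, Fintype.sum_prod_type]

lemma matK_J (m n : ℕ) : matK m n * matJ _ = (n : ℝ) • matJ _ := by
  ext p q
  simp only [matK, matJ, Matrix.mul_apply, Matrix.of_apply, Fintype.sum_prod_type,
    Matrix.smul_apply]
  rw [Finset.sum_eq_single p.1]
  · simp
  · intro b _ hb; simp [hb.symm]
  · simp

lemma matJ_K (m n : ℕ) : matJ _ * matK m n = (n : ℝ) • matJ _ := by
  have := congrArg Matrix.transpose (matK_J m n)
  simpa [Matrix.transpose_mul, matK_t, matJ_t] using this

lemma matJ_sq (m n : ℕ) : matJ (Fin m × Fin n) * matJ _ = ((m : ℝ) * n) • matJ _ := by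
  ext p q
  simp [matJ, Matrix.mul_apply]

section
variable {f m n k l1 l2 σ τ ρ : ℕ}
  {A : Fin f → Fin f → Matrix (Fin m × Fin n) (Fin m × Fin n) ℝ}

lemma lk_zero (hA : IsLinkedSGDDII A k l1 l2 σ τ ρ) {i j} (h : i ≠ j) {p q : Fin m × Fin n}
    (hpq : p.1 = q.1) : A i j p q = 0 := by
  have h1 := (hA.2.1 i j h).1 p q
  have h2 := hA.2.2.1 i j h p q
  simp only [Matrix.add_apply, matK, Matrix.of_apply, if_pos hpq] at h2
  rcases h1 with h1 | h1
  · exact h1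
  · rw [h1] at h2; norm_num at h2

lemma lk_J (hA : IsLinkedSGDDII A k l1 l2 σ τ ρ) {i j} (h : i ≠ j) :
    A i j * matJ _ = (k : ℝ) • matJ _ := by
  ext p q
  have h1 := (hA.2.1 i j h).1
  have h2 := congrFun (congrFun (hA.2.1 i j h).2.1 p) p
  simp only [Matrix.mul_apply, Matrix.transpose_apply, Matrix.add_apply, Matrix.smul_apply,
    Matrix.sub_apply, matK, matJ, Matrix.of_apply, Matrix.one_apply] at h2
  simp only [Matrix.mul_apply, matJ, Matrix.of_apply, Matrix.smul_apply]
  simp at h2 ⊢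
  rw [← h2]
  refine Finset.sum_congr rfl fun r _ => ?_
  rcases h1 p r with h | h <;> simp [h]

lemma J_lk (hA : IsLinkedSGDDII A k l1 l2 σ τ ρ) {i j} (h : i ≠ j) :
    matJ _ * A i j = (k : ℝ) • matJ _ := by
  have := congrArg Matrix.transpose (lk_J hA h.symm)
  simpa [Matrix.transpose_mul, hA.1 j i h.symm, matJ_t] using this

/-- the representing matrices with base point `i0`. -/
noncomputable def matB (A : Fin f → Fin f → Matrix (Fin m × Fin n) (Fin m × Fin n) ℝ)
    (i0 : Fin f) (s : ℝ) (i : Fin f) : Matrix (Fin m × Fin n) (Fin m × Fin n) ℝ :=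
  if i = i0 then s • 1 else A i0 i

/-- commuting case -/
lemma lk_comm (hm : 1 < m) (hn : 1 < n) (hk1 : l1 < k)
    (hA : IsLinkedSGDDII A k l1 l2 σ τ ρ) (i0 : Fin f)
    (hc : ∀ j, i0 ≠ j → matK m n * A i0 j = A i0 j * matK m n) : f ≤ m := by
  have hn0 : (n : ℝ) ≠ 0 := by positivity
  have hn1 : (1 : ℝ) < n := by exact_mod_cast hn
  have hkl : (0 : ℝ) < k - l1 := by
    have : (l1 : ℝ) < k := by exact_mod_cast hk1
    linarith
  let a : Fin m := ⟨0, by omega⟩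
  have key := aux_proj (matD m n a) ((n : ℝ)⁻¹ • matK m n) (matB A i0 (Real.sqrt (k - l1)))
    (k - l1) hkl (matD_t m n a) (matD_sq m n hn a) (by simp [matK_t])
    (by simp [matK_sq, smul_smul, hn0]) ?_ ?_
  · rw [matD_trace m n hn, Matrix.trace_smul, matK_trace] at key
    simp only [Fintype.card_fin, Fintype.card_prod, smul_eq_mul, Nat.cast_mul] at key
    have e : (n : ℝ)⁻¹ * (m * n) = m := by field_simp
    rw [e] at key
    have : (f : ℝ) * (n - 1) ≤ m * (n - 1) := by linarith
    have := le_of_mul_le_mul_right this (by linarith)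
    exact_mod_cast this
  · intro i
    unfold matB
    split_ifs with h
    · simp [matK_matD m n hn]
    · rw [Matrix.smul_mul, hc i (Ne.symm h), Matrix.smul_mul, Matrix.mul_assoc,
        matK_matD m n hn]; simp
  · intro i j
    unfold matB
    by_cases hij : i = j
    · subst hij
      by_cases hi : i = i0
      · simp only [hi, if_true, Matrix.transpose_smul, Matrix.transpose_one, Matrix.smul_mul,
          Matrix.mul_smul, Matrix.mul_one, matD_sq m n hn, smul_smul]
        rw [Real.mul_self_sqrt hkl.le]
      · simp only [hi, if_true, if_false]
        rw [(hA.2.1 i0 i (Ne.symm hi)).2.2]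
        have e : (k : ℝ) • (1 : Matrix (Fin m × Fin n) (Fin m × Fin n) ℝ)
            + (l1 : ℝ) • (matK m n - 1) + (l2 : ℝ) • (matJ (Fin m × Fin n) - matK m n)
            = ((k : ℝ) - l1) • 1 + ((l1 : ℝ) • matK m n +
              (l2 : ℝ) • (matJ (Fin m × Fin n) - matK m n)) := by
          module
        rw [e, Matrix.mul_add, Matrix.add_mul, matD_const m n hn a ((l1 : ℝ) • matK m n +
              (l2 : ℝ) • (matJ (Fin m × Fin n) - matK m n)) l1]
        · simp [matD_sq m n hn]
        · intro p q hp hq; simp [matK, matJ, hp, hq]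
    · simp only [hij, if_false]
      by_cases hi : i = i0
      · subst hi
        simp only [if_true, Ne.symm hij, if_false]
        apply matD_const m n hn a _ 0
        intro p q hp hq
        simp [lk_zero hA hij (hp.trans hq.symm)]
      · by_cases hj : j = i0
        · subst hj
          simp only [if_true, hi, if_false]
          apply matD_const m n hn a _ 0
          intro p q hp hq
          simp [lk_zero hA (Ne.symm hij) (hq.trans hp.symm)]
        · simp only [hi, hj, if_false]
          rw [hA.1 i0 i (Ne.symm hi), hA.2.2.2 i i0 j hi (Ne.symm hj) hij]
          apply matD_const m n hn a _ ρ
          intro p q hp hq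
          simp [lk_zero hA hij (hp.trans hq.symm), matK, matJ, hp, hq]
lemma lk_sym (hA : IsLinkedSGDDII A k l1 l2 σ τ ρ) (hl : l1 = l2) {i j} (h : i ≠ j) :
    A i j * A j i = ((k : ℝ) - l1) • 1 + (l1 : ℝ) • matJ _ := by
  subst hl
  rw [← hA.1 i j h, (hA.2.1 i j h).2.1]
  module

lemma lk_link (hA : IsLinkedSGDDII A k l1 l2 σ τ ρ) {i j l} (h1 : i ≠ j) (h2 : j ≠ l)
    (h3 : i ≠ l) : A i j * A j l = ((σ : ℝ) - τ) • A i l + (τ : ℝ) • matJ _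
      + ((ρ : ℝ) - τ) • matK m n := by
  rw [hA.2.2.2 i j l h1 h2 h3]
  module

lemma KA_diag (hA : IsLinkedSGDDII A k l1 l2 σ τ ρ) {i j} (h : i ≠ j) (p : Fin m × Fin n) :
    (matK m n * A i j) p p = 0 := by
  rw [Matrix.mul_apply]
  refine Finset.sum_eq_zero fun r _ => ?_
  by_cases hr : p.1 = r.1
  · rw [lk_zero hA h hr.symm]; simp
  · simp [matK, hr]

lemma lk_main (hA : IsLinkedSGDDII A k l1 l2 σ τ ρ) (hl : l1 = l2) {i j l} (h1 : i ≠ j)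
    (h2 : j ≠ l) (h3 : i ≠ l) (p q : Fin m × Fin n) :
    ((k : ℝ) - l1 - ((σ : ℝ) - τ) ^ 2) * A i j p q = ((ρ : ℝ) - τ) *
      ((matK m n * A l j) p q + ((σ : ℝ) - τ) * matK m n p q - ((σ : ℝ) - τ)) := by
  have e : A i j * (A j l * A l j) = (A i j * A j l) * A l j := by rw [Matrix.mul_assoc]
  rw [lk_sym hA hl h2, lk_link hA h1 h2 h3, Matrix.mul_add, Matrix.add_mul, Matrix.add_mul,
    Matrix.smul_mul, Matrix.smul_mul, Matrix.smul_mul, lk_link hA h3 h2.symm h1,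
    Matrix.mul_smul, Matrix.mul_smul, lk_J hA h1, J_lk hA h2.symm, Matrix.mul_one] at e
  have ep := congrFun (congrFun e p) p
  have eq := congrFun (congrFun e p) q
  simp only [Matrix.add_apply, Matrix.smul_apply, smul_eq_mul, KA_diag hA h2.symm,
    lk_zero hA h1 (rfl : p.1 = p.1)] at ep eq
  simp only [matJ, Matrix.of_apply] at ep eq
  have : matK m n p p = 1 := by simp [matK]
  rw [this] at ep
  linear_combination eq - ep

lemma lk_d (hm : 1 < m) (hn : 1 < n) (hk1 : l1 < k)
    (hA : IsLinkedSGDDII A k l1 l2 σ τ ρ) (hl : l1 = l2) {i j l : Fin f} (h1 : i ≠ j)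
    (h2 : j ≠ l) (h3 : i ≠ l) : (k : ℝ) - l1 = ((σ : ℝ) - τ) ^ 2 := by
  by_contra hne
  have hne' : (k : ℝ) - l1 - ((σ : ℝ) - τ) ^ 2 ≠ 0 := sub_ne_zero.mpr hne
  let p : Fin m × Fin n := (⟨0, by omega⟩, ⟨0, by omega⟩)
  let p' : Fin m × Fin n := (⟨0, by omega⟩, ⟨1, by omega⟩)
  have hpp : p ≠ p' := by simp [p, p']
  have hr : ∀ q, A i j p q = A i j p' q := by
    intro q
    apply mul_left_cancel₀ hne'
    rw [lk_main hA hl h1 h2 h3, lk_main hA hl h1 h2 h3]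
    simp [Matrix.mul_apply, matK, p, p']
  have e := (hA.2.1 i j h1).2.1
  have e1 := congrFun (congrFun e p) p
  have e2 := congrFun (congrFun e p) p'
  have e3 : (A i j * (A i j)ᵀ) p p = (A i j * (A i j)ᵀ) p p' := by
    simp only [Matrix.mul_apply, Matrix.transpose_apply, hr]
  rw [e1, e2] at e3
  have hk : matK m n p p' = 1 := by simp [matK, p, p']
  have hk' : matK m n p p = 1 := by simp [matK]
  simp [hk, hk', Matrix.one_apply, hpp, matJ] at e3
  omega

/-- the equality case -/
lemma lk_trace (hm : 1 < m) (hn : 1 < n)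
    (hA : IsLinkedSGDDII A k l1 l2 σ τ ρ) (hl : l1 = l2) (d : ℝ) (hd : (k : ℝ) - l1 = d ^ 2)
    (hkl : (k : ℝ) ^ 2 = d ^ 2 + l1 * (m * n))
    {i j} (h : i ≠ j) (X : Matrix (Fin m × Fin n) (Fin m × Fin n) ℝ)
    (hX : X = A i j * matK m n - d • matK m n - (((k : ℝ) - d) / m) • matJ _) :
    (Xᵀ * X).trace = 2 * n ^ 2 * d * (d * (m - 1) + k) := by
  set c : ℝ := ((k : ℝ) - d) / m with hc
  have hm0 : (m : ℝ) ≠ 0 := by positivity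
  have hXt : Xᵀ = matK m n * A j i - d • matK m n - c • matJ _ := by
    rw [hX]
    simp [Matrix.transpose_mul, matK_t, matJ_t, hA.1 i j h]
  have hJt : (matJ (Fin m × Fin n)).trace = m * n := by
    simp [matJ, Matrix.trace]
  have t1 : ∀ {i j}, i ≠ j → (matK m n * (A i j * matK m n)).trace = 0 := by
    intro i j h
    rw [← Matrix.mul_assoc, Matrix.trace_mul_comm, ← Matrix.mul_assoc, matK_sq, Matrix.smul_mul,
      Matrix.trace_smul]
    have : (matK m n * A i j).trace = 0 := by
      rw [Matrix.trace]
      exact Finset.sum_eq_zero fun p _ => KA_diag hA h p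
    rw [this]; simp
  have t2 : (matK m n * A j i * (A i j * matK m n)) =
      (d ^ 2 * n) • matK m n + (l1 * n * n : ℝ) • matJ _ := by
    have : matK m n * A j i * (A i j * matK m n) = matK m n * (A j i * A i j) * matK m n := by
      simp only [Matrix.mul_assoc]
    rw [this, lk_sym hA hl h.symm, hd]
    simp only [Matrix.mul_add, Matrix.add_mul, Matrix.mul_smul, Matrix.smul_mul, Matrix.mul_one,
      matK_sq, matK_J, matJ_K, smul_smul]
  have t3 : matK m n * A j i * matJ _ = (k * n : ℝ) • matJ _ := by
    rw [Matrix.mul_assoc, lk_J hA h.symm, Matrix.mul_smul, matK_J, smul_smul]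
  have t4 : matJ _ * (A i j * matK m n) = (k * n : ℝ) • matJ _ := by
    rw [← Matrix.mul_assoc, J_lk hA h, Matrix.smul_mul, matJ_K, smul_smul]
  rw [hXt, hX]
  simp only [Matrix.mul_sub, Matrix.sub_mul, Matrix.mul_smul, Matrix.smul_mul, t2, t3, t4,
    matK_sq, matK_J, matJ_K, matJ_sq, Matrix.trace_sub, Matrix.trace_add, Matrix.trace_smul,
    t1 h, hJt, matK_trace, smul_eq_mul]
  have t5 : (matK m n * A j i * matK m n).trace = 0 := by rw [Matrix.mul_assoc]; exact t1 h.symm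
  rw [t5]
  have hc' : c * m = k - d := by rw [hc]; field_simp
  have hl' : (l1 : ℝ) * (m * n) = k ^ 2 - d ^ 2 := by linarith
  have hcc : c * c * m * m = (k - d) ^ 2 := by rw [← hc']; ring
  linear_combination (n : ℝ) ^ 2 * hl' + n ^ 2 * hcc - 2 * (k - d) * n ^ 2 * hc'

lemma lk_gram (hA : IsLinkedSGDDII A k l1 l2 σ τ ρ) (hl : l1 = l2) (hr : ρ = τ) (d : ℝ)
    (hd : (k : ℝ) - l1 = d ^ 2) (i0 : Fin f) (a : Fin m) (i j : Fin f) (b c : Fin n) :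
    ∑ p, matB A i0 d i p (a, b) * matB A i0 d j p (a, c) =
      (if (i, b) = (j, c) then d ^ 2 else 0)
        + (τ * (if i = i0 then 0 else 1) * (if j = i0 then 0 else 1)
        + ((l1 : ℝ) - τ) * if i = j then (if i = i0 then 0 else 1) else 0) := by
  have e : ∑ p, matB A i0 d i p (a, b) * matB A i0 d j p (a, c)
      = ((matB A i0 d i)ᵀ * matB A i0 d j) (a, b) (a, c) := by
    simp [Matrix.mul_apply]
  rw [e]
  unfold matB
  by_cases hi : i = i0
  · by_cases hj : j = i0
    · subst hi; subst hj
      simp [Matrix.one_apply, sq]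
    · subst hi
      simp [hj, Ne.symm hj, lk_zero hA (Ne.symm hj) (p := (a, b)) (q := (a, c)) rfl]
  · by_cases hj : j = i0
    · subst hj
      simp [hi, lk_zero hA (Ne.symm hi) (p := (a, c)) (q := (a, b)) rfl]
    · by_cases hij : i = j
      · subst hij
        simp only [hi, if_false, hA.1 i0 i (Ne.symm hi), lk_sym hA hl hi, hd]
        simp [Matrix.one_apply, matJ]
      · simp only [hi, hj, if_false, hA.1 i0 i (Ne.symm hi), lk_link hA hi (Ne.symm hj) hij]
        simp [hij, matJ, hr, lk_zero hA hij (p := (a, b)) (q := (a, c)) rfl]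

lemma lk_quad (hA : IsLinkedSGDDII A k l1 l2 σ τ ρ) (hl : l1 = l2) (hr : ρ = τ) (d : ℝ)
    (hd : (k : ℝ) - l1 = d ^ 2) (i0 : Fin f) (a : Fin m) (w : Fin f × Fin n → ℝ) :
    ∑ p, (∑ x, matB A i0 d x.1 p (a, x.2) * w x) ^ 2 =
      d ^ 2 * ∑ x, w x ^ 2
        + τ * (∑ i, (if i = i0 then 0 else 1) * ∑ b, w (i, b)) ^ 2
        + ((l1 : ℝ) - τ) * ∑ i, (if i = i0 then 0 else 1) * (∑ b, w (i, b)) ^ 2 := by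
  have e1 : ∑ p, (∑ x, matB A i0 d x.1 p (a, x.2) * w x) ^ 2 =
      ∑ x, ∑ y, (w x * w y) * ∑ p, matB A i0 d x.1 p (a, x.2) * matB A i0 d y.1 p (a, y.2) := by
    have e0 : ∀ p, (∑ x, matB A i0 d x.1 p (a, x.2) * w x) ^ 2 =
        ∑ x, ∑ y, (matB A i0 d x.1 p (a, x.2) * w x) * (matB A i0 d y.1 p (a, y.2) * w y) := by
      intro p; rw [sq, Finset.sum_mul_sum]
    simp only [e0, Finset.mul_sum]
    rw [Finset.sum_comm]
    refine Finset.sum_congr rfl fun x _ => ?_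
    rw [Finset.sum_comm]
    refine Finset.sum_congr rfl fun y _ => Finset.sum_congr rfl fun p _ => ?_
    ring
  rw [e1]
  simp only [lk_gram hA hl hr d hd, mul_add, Finset.sum_add_distrib]
  rw [← add_assoc]
  congr 1
  congr 1
  · rw [Finset.mul_sum]
    refine Finset.sum_congr rfl fun x _ => ?_
    simp only [Prod.mk.eta, mul_ite, mul_zero, Finset.sum_ite_eq, Finset.mem_univ, if_true]
    ring
  · have : ∑ i, (if i = i0 then (0 : ℝ) else 1) * ∑ b, w (i, b)
        = ∑ x : Fin f × Fin n, (if x.1 = i0 then (0 : ℝ) else 1) * w x := by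
      rw [Fintype.sum_prod_type]
      simp only [Finset.mul_sum]
    rw [this, sq, Finset.sum_mul_sum, Finset.mul_sum]
    refine Finset.sum_congr rfl fun x _ => ?_
    rw [Finset.mul_sum]
    refine Finset.sum_congr rfl fun y _ => ?_
    ring
  · rw [Fintype.sum_prod_type, Finset.mul_sum]
    refine Finset.sum_congr rfl fun i _ => ?_
    rw [sq, Finset.sum_mul_sum, Finset.mul_sum, Finset.mul_sum]
    refine Finset.sum_congr rfl fun b _ => ?_
    rw [Fintype.sum_prod_type, Finset.sum_eq_single i, Finset.mul_sum, Finset.mul_sum]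
    · refine Finset.sum_congr rfl fun c _ => ?_
      simp only [if_true]
      ring
    · intro j _ hj
      simp [Ne.symm hj]
    · simp

lemma lk_pos (hm : 1 < m) (hn : 1 < n) (hA : IsLinkedSGDDII A k l1 l2 σ τ ρ) (hl : l1 = l2)
    (hr : ρ = τ) (d : ℝ) (hd : (k : ℝ) - l1 = d ^ 2) (hd1 : 1 ≤ d)
    (hkl : (k : ℝ) ^ 2 = d ^ 2 + l1 * (m * n)) (hkt : (k : ℝ) ^ 2 = d * k + τ * (m * n))
    (i0 : Fin f) : f ≤ m := by
  let a : Fin m := ⟨0, by omega⟩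
  have hf : (1 : ℝ) ≤ f := by
    have := i0.pos
    exact_mod_cast this
  have hn0 : (0 : ℝ) < n := by positivity
  have q := lk_quad hA hl hr d hd i0 a (fun _ => 1)
  have hg : ∑ i : Fin f, (if i = i0 then (0 : ℝ) else 1) = f - 1 := by
    have : ∀ i, (if i = i0 then (0 : ℝ) else 1) = 1 - if i = i0 then 1 else 0 := by
      intro i; split_ifs <;> simp
    simp [this, Finset.sum_sub_distrib]
  have cs := sq_sum_le_card_mul_sum_sq (s := Finset.univ)
    (f := fun p => ∑ x : Fin f × Fin n, matB A i0 d x.1 p (a, x.2) * 1)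
  rw [q] at cs
  have hs : ∑ p, ∑ x : Fin f × Fin n, matB A i0 d x.1 p (a, x.2) * 1
      = n * (d + (f - 1) * k) := by
    rw [Finset.sum_comm, Fintype.sum_prod_type]
    have : ∀ i b, ∑ p, matB A i0 d i p (a, b) * 1 =
        d + (k - d) * (if i = i0 then (0 : ℝ) else 1) := by
      intro i b
      unfold matB
      by_cases hi : i = i0
      · simp [hi, Matrix.one_apply]
      · have := congrFun (congrFun (J_lk hA (Ne.symm hi)) (a, b)) (a, b)
        simp [Matrix.mul_apply, matJ] at this
        simp [hi, this]
    simp only [this, Finset.sum_const, Finset.sum_add_distrib, ← Finset.mul_sum, ← Finset.smul_sum,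
      hg, smul_add]
    simp
    ring
  rw [hs] at cs
  simp only [← Finset.sum_mul, hg, Finset.card_univ, Fintype.card_prod, Fintype.card_fin,
    Finset.sum_const, one_pow, nsmul_eq_mul, mul_one, Nat.cast_mul] at cs
  have h1 : ((n : ℝ) ^ 2 * d * f) * ((f - 1) * k) ≤ (n ^ 2 * d * f) * (d * (m - 1)) := by
    have e1 : (l1 : ℝ) * (m * n) = k ^ 2 - d ^ 2 := by linarith
    have e2 : (τ : ℝ) * (m * n) = k ^ 2 - d * k := by linarith
    have : (m * n : ℝ) * (d ^ 2 * (f * n) + τ * ((f - 1) * n) ^ 2 + (l1 - τ) * ((f - 1) * n ^ 2))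
      = m * n * (d ^ 2 * (f * n)) + (k ^ 2 - d * k) * ((f - 1) * n) ^ 2
        + ((k ^ 2 - d ^ 2) - (k ^ 2 - d * k)) * ((f - 1) * n ^ 2) := by
      rw [← e1, ← e2]; ring
    rw [this] at cs
    linarith
  have h2 := le_of_mul_le_mul_left h1 (by positivity)
  have hkd : d ≤ k := by
    have : (0 : ℝ) ≤ l1 := by positivity
    nlinarith
  have h3 : d * ((f : ℝ) - 1) ≤ d * (m - 1) := by nlinarith
  have h4 := le_of_mul_le_mul_left h3 (by linarith)
  have : (f : ℝ) ≤ m := by linarith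
  exact_mod_cast this

lemma lk_neg (hm : 1 < m) (hn : 1 < n) (hA : IsLinkedSGDDII A k l1 l2 σ τ ρ) (hl : l1 = l2)
    (hr : ρ = τ) (d : ℝ) (hd : (k : ℝ) - l1 = d ^ 2) (hd1 : d < 0)
    (hkl : (k : ℝ) ^ 2 = d ^ 2 + l1 * (m * n)) (hkt : (k : ℝ) ^ 2 = d * k + τ * (m * n))
    (hs : d * (m - 1) + k < 0) (i0 : Fin f) : f ≤ m := by
  let a : Fin m := ⟨0, by omega⟩
  have hn0 : (0 : ℝ) < n := by positivity
  have hm0 : (0 : ℝ) < m := by positivity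
  let N : Matrix (Fin m × Fin n) (Fin f × Fin n) ℝ :=
    Matrix.of fun p x => matB A i0 d x.1 p (a, x.2)
  have inj : Function.Injective N.mulVecLin := by
    rw [← LinearMap.ker_eq_bot, LinearMap.ker_eq_bot']
    intro w hw
    have q := lk_quad hA hl hr d hd i0 a w
    have h0 : ∑ p, (∑ x, matB A i0 d x.1 p (a, x.2) * w x) ^ 2 = 0 := by
      refine Finset.sum_eq_zero fun p _ => ?_
      have := congrFun hw p
      simp only [Matrix.mulVecLin_apply, Matrix.mulVec, dotProduct, N, Matrix.of_apply,
        Pi.zero_apply] at this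
      rw [this]; simp
    rw [h0] at q
    set W := ∑ x, w x ^ 2 with hW
    set S := ∑ i, (if i = i0 then (0 : ℝ) else 1) * (∑ b, w (i, b)) ^ 2 with hS
    have hSW : S ≤ n * W := by
      rw [hS, hW, Fintype.sum_prod_type, Finset.mul_sum]
      refine Finset.sum_le_sum fun i _ => ?_
      have cs := sq_sum_le_card_mul_sum_sq (s := Finset.univ) (f := fun b => w (i, b))
      simp only [Finset.card_univ, Fintype.card_fin] at cs
      have := sq_nonneg (∑ b, w (i, b))
      split_ifs <;> linarith
    have hW0 : 0 ≤ W := Finset.sum_nonneg fun x _ => sq_nonneg _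
    have hT : 0 ≤ (τ : ℝ) * (∑ i, (if i = i0 then (0 : ℝ) else 1) * ∑ b, w (i, b)) ^ 2 := by
      positivity
    have h1 : d ^ 2 * W + (l1 - τ) * S ≤ 0 := by linarith
    have e : ((l1 : ℝ) - τ) * (m * n) = d * k - d ^ 2 := by linarith
    have h2 : (m * n : ℝ) * (d ^ 2 * W) + (d * k - d ^ 2) * S ≤ 0 := by
      rw [← e]
      have : 0 ≤ (m * n : ℝ) := by positivity
      nlinarith
    have hk0 : (0 : ℝ) ≤ k := by positivity
    have h3 : (d * k - d ^ 2) * (n * W) ≤ (d * k - d ^ 2) * S := by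
      apply mul_le_mul_of_nonpos_left hSW
      nlinarith
    have h4 : (n * (d * (d * (m - 1) + k))) * W ≤ 0 := by linarith
    have h5 : 0 < n * (d * (d * (m - 1) + k)) := mul_pos hn0 (mul_pos_of_neg_of_neg hd1 hs)
    have h6 : W = 0 := by
      apply le_antisymm _ hW0
      by_contra hc
      push Not at hc
      have := mul_pos h5 hc
      linarith
    rw [hW, Finset.sum_eq_zero_iff_of_nonneg (fun x _ => sq_nonneg _)] at h6
    ext x
    simpa using h6 x (Finset.mem_univ x)
  have := LinearMap.finrank_le_finrank_of_injective inj
  simp only [Module.finrank_fintype_fun_eq_card, Fintype.card_prod, Fintype.card_fin] at this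
  exact Nat.le_of_mul_le_mul_right this (by omega)
end

theorem stmt13 (f m n k l1 l2 σ τ ρ : ℕ) (hm : 1 < m) (hn : 1 < n)
    (hk1 : l1 < k) (hk2 : k < (m - 1) * n) (hf : 3 ≤ f)
    (A : Fin f → Fin f → Matrix (Fin m × Fin n) (Fin m × Fin n) ℝ)
    (hA : IsLinkedSGDDII A k l1 l2 σ τ ρ) :
    f ≤ m := by
  let i0 : Fin f := ⟨0, by omega⟩
  let i1 : Fin f := ⟨1, by omega⟩
  let i2 : Fin f := ⟨2, by omega⟩
  have h01 : i0 ≠ i1 := by simp [i0, i1]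
  have h02 : i0 ≠ i2 := by simp [i0, i2]
  have h12 : i1 ≠ i2 := by simp [i1, i2]
  by_cases hl : l1 = l2
  swap
  · apply lk_comm hm hn hk1 hA i0
    intro j hj
    have e : A i0 j * ((A i0 j)ᵀ * A i0 j) = (A i0 j * (A i0 j)ᵀ) * A i0 j := by
      rw [Matrix.mul_assoc]
    rw [(hA.2.1 i0 j hj).2.1, (hA.2.1 i0 j hj).2.2] at e
    simp only [Matrix.mul_add, Matrix.add_mul, Matrix.mul_smul, Matrix.smul_mul, Matrix.mul_sub,
      Matrix.sub_mul, Matrix.mul_one, Matrix.one_mul, lk_J hA hj, J_lk hA hj] at e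
    have hne : (l1 : ℝ) - l2 ≠ 0 := by
      rw [sub_ne_zero]; exact_mod_cast hl
    have e2 : ((l1 : ℝ) - l2) • (matK m n * A i0 j) = ((l1 : ℝ) - l2) • (A i0 j * matK m n) := by
      ext p q
      have e3 := congrFun (congrFun e p) q
      simp only [Matrix.add_apply, Matrix.sub_apply, Matrix.smul_apply, smul_eq_mul] at e3 ⊢
      linarith
    exact smul_right_injective _ hne e2
  have hd := lk_d hm hn hk1 hA hl h01 h12 h02
  by_cases hr : ρ = τ
  swap
  · have hne : (ρ : ℝ) - τ ≠ 0 := by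
      rw [sub_ne_zero]; exact_mod_cast hr
    have hKA : ∀ l j, l ≠ j → matK m n * A l j = ((σ : ℝ) - τ) • (matJ _ - matK m n) := by
      intro l j hlj
      obtain ⟨i, hi⟩ : ∃ i : Fin f, i ∉ ({l, j} : Finset (Fin f)) := by
        by_contra hc
        push Not at hc
        have h1 : (Finset.univ : Finset (Fin f)) ⊆ {l, j} := fun x _ => hc x
        have h2 := Finset.card_le_card h1
        have h3 : ({l, j} : Finset (Fin f)).card ≤ 2 := Finset.card_le_two
        simp at h2
        omega
      simp only [Finset.mem_insert, Finset.mem_singleton, not_or] at hi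
      ext p q
      have := lk_main hA hl hi.2 hlj.symm hi.1 p q
      rw [hd, sub_self, zero_mul, eq_comm, mul_eq_zero] at this
      have := this.resolve_left hne
      simp only [Matrix.smul_apply, Matrix.sub_apply, smul_eq_mul]
      have hJ : matJ (Fin m × Fin n) p q = 1 := rfl
      rw [hJ]
      linarith
    apply lk_comm hm hn hk1 hA i0
    intro j hj
    rw [hKA i0 j hj]
    have := congrArg Matrix.transpose (hKA j i0 hj.symm)
    rw [Matrix.transpose_mul, hA.1 j i0 hj.symm, matK_t] at this
    rw [this]
    simp [matK_t, matJ_t]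
  have hn0 : (0 : ℝ) < n := by positivity
  have hm0 : (0 : ℝ) < m := by positivity
  let p : Fin m × Fin n := (⟨0, by omega⟩, ⟨0, by omega⟩)
  obtain ⟨d, hdd⟩ : ∃ d : ℤ, (d : ℝ) = (σ : ℝ) - τ := ⟨(σ : ℤ) - τ, by push_cast; ring⟩
  rw [← hdd] at hd
  have hJp : matJ (Fin m × Fin n) p p = 1 := rfl
  have hkt : (k : ℝ) ^ 2 = d * k + τ * (m * n) := by
    have e : A i0 i1 * (A i1 i2 * matJ _) = (A i0 i1 * A i1 i2) * matJ _ := by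
      rw [Matrix.mul_assoc]
    rw [lk_link hA h01 h12 h02, lk_J hA h12, Matrix.mul_smul, lk_J hA h01, hr, ← hdd] at e
    simp only [sub_self, zero_smul, add_zero, Matrix.add_mul, Matrix.smul_mul, lk_J hA h02,
      matJ_sq] at e
    have := congrFun (congrFun e p) p
    simp only [Matrix.add_apply, Matrix.smul_apply, smul_eq_mul, hJp] at this
    linarith
  have hkl : (k : ℝ) ^ 2 = d ^ 2 + l1 * (m * n) := by
    have e : A i0 i1 * (A i1 i0 * matJ _) = (A i0 i1 * A i1 i0) * matJ _ := by
      rw [Matrix.mul_assoc]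
    rw [lk_sym hA hl h01, lk_J hA h01.symm, Matrix.mul_smul, lk_J hA h01, hd] at e
    simp only [Matrix.add_mul, Matrix.smul_mul, Matrix.one_mul, matJ_sq] at e
    have := congrFun (congrFun e p) p
    simp only [Matrix.add_apply, Matrix.smul_apply, smul_eq_mul, hJp] at this
    linarith
  have hd0 : d ≠ 0 := by
    rintro rfl
    have : (l1 : ℝ) < k := by exact_mod_cast hk1
    norm_num at hd
    linarith
  rcases lt_or_gt_of_ne hd0 with hneg | hpos
  · have hneg' : (d : ℝ) < 0 := by exact_mod_cast hneg
    have nn : ∀ X : Matrix (Fin m × Fin n) (Fin m × Fin n) ℝ, 0 ≤ (Xᵀ * X).trace := by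
      intro X
      rw [Matrix.trace]
      refine Finset.sum_nonneg fun p _ => ?_
      simp only [Matrix.diag_apply, Matrix.mul_apply, Matrix.transpose_apply]
      exact Finset.sum_nonneg fun q _ => mul_self_nonneg _
    rcases lt_trichotomy ((d : ℝ) * (m - 1) + k) 0 with hs | hs | hs
    · exact lk_neg hm hn hA hl hr d hd hneg' hkl hkt hs i0
    · have hX : ∀ i j, i ≠ j → A i j * matK m n
          = (d : ℝ) • matK m n + (((k : ℝ) - d) / m) • matJ _ := by
        intro i j h
        have t := lk_trace hm hn hA hl d hd hkl h _ rfl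
        rw [hs, mul_zero, ← Matrix.conjTranspose_eq_transpose_of_trivial,
          Matrix.trace_conjTranspose_mul_self_eq_zero_iff] at t
        rw [sub_sub, sub_eq_zero] at t
        exact t
      apply lk_comm hm hn hk1 hA i0
      intro j hj
      rw [hX i0 j hj]
      have := congrArg Matrix.transpose (hX j i0 hj.symm)
      rw [Matrix.transpose_mul, hA.1 j i0 hj.symm, matK_t] at this
      rw [this]
      simp [matK_t, matJ_t]
    · exfalso
      have t := lk_trace hm hn hA hl d hd hkl h01 _ rfl
      have := nn (A i0 i1 * matK m n - (d : ℝ) • matK m n - (((k : ℝ) - d) / m) • matJ _)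
      rw [t] at this
      have h1 : 2 * (n : ℝ) ^ 2 * d < 0 := mul_neg_of_pos_of_neg (by positivity) hneg'
      have := mul_neg_of_neg_of_pos h1 hs
      linarith
  · have hpos' : (1 : ℝ) ≤ d := by exact_mod_cast hpos
    exact lk_pos hm hn hA hl hr d hd hpos' hkl hkt i0
end

section
/- Let n ≥ 4 be even and let C be an n×n matrix with entries in {0,1,−1}, zero diagonal, and C·Cᵀ = (n−1)·I_n (a conference matrix of order n). Define the 2n×2n (0,1)-matrix A, indexed by {1,…,n}×{1,2}, by A((i,a),(j,b)) = 1 if either C_{ij} = 1 and a = b, or C_{ij} = −1 and a ≠ b, and A((i,a),(j,b)) = 0 otherwise. Then A is an SGDD with parameters (2n, n−1, n, 2, 0, n/2−1), i.e., A·Aᵀ = Aᵀ·A = (n−1)·I_{2n} + (n/2−1)·(J_{2n} − K_{n,2}); moreover A + K_{n,2} is a (0,1)-matrix and A·K_{n,2} = K_{n,2}·A = J_{2n} − K_{n,2}. -/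
open Matrix

attribute [local instance] Classical.propDecidable

/-- The sign attached to an element of `Fin 2`. -/
def sgn2 (a : Fin 2) : ℝ := if a = 0 then 1 else -1

/-- The indicator of being different. -/
def offD {n : ℕ} (i j : Fin n) : ℝ := if i = j then 0 else 1

theorem sum_offD {n : ℕ} (i : Fin n) : ∑ j, offD i j = (n : ℝ) - 1 := by
  have h : ∀ j : Fin n, offD i j = 1 - (if i = j then (1 : ℝ) else 0) := by
    intro j; unfold offD; split_ifs <;> norm_num
  simp only [h, Finset.sum_sub_distrib, Finset.sum_ite_eq, Finset.mem_univ, if_true]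
  simp

theorem sum_offD_mul {n : ℕ} (i k : Fin n) :
    ∑ j, offD i j * offD k j = if i = k then (n : ℝ) - 1 else (n : ℝ) - 2 := by
  by_cases hik : i = k
  · subst hik
    rw [if_pos rfl, ← sum_offD i]
    refine Finset.sum_congr rfl fun j _ => ?_
    unfold offD; split_ifs <;> norm_num
  · have h : ∀ j : Fin n, offD i j * offD k j
        = offD i j - (if k = j then (1 : ℝ) else 0) := by
      intro j; unfold offD
      by_cases h1 : i = j <;> by_cases h2 : k = j
      · exact absurd (h1.trans h2.symm) hik
      all_goals simp [h1, h2]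
    simp only [h, Finset.sum_sub_distrib, sum_offD, Finset.sum_ite_eq, Finset.mem_univ, if_true,
      if_neg hik]
    ring

theorem core_mul {n : ℕ} (C : Matrix (Fin n) (Fin n) ℝ)
    (hconf : C * Cᵀ = ((n : ℝ) - 1) • (1 : Matrix (Fin n) (Fin n) ℝ))
    (A : Matrix (Fin n × Fin 2) (Fin n × Fin 2) ℝ)
    (hA : ∀ p q, A p q = (offD p.1 q.1 + sgn2 p.2 * sgn2 q.2 * C p.1 q.1) / 2) :
    A * Aᵀ = ((n : ℝ) - 1) • (1 : Matrix (Fin n × Fin 2) (Fin n × Fin 2) ℝ)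
      + ((n : ℝ) / 2 - 1) • (matJ (Fin n × Fin 2) - matK n 2) := by
  ext ⟨i, a⟩ ⟨k, b⟩
  have hc : ∑ j, C i j * C k j = if i = k then (n : ℝ) - 1 else 0 := by
    have := congrFun (congrFun hconf i) k
    simpa [Matrix.mul_apply, Matrix.one_apply] using this
  have hs : (A * Aᵀ) (i, a) (k, b)
      = (∑ j, offD i j * offD k j + sgn2 a * sgn2 b * ∑ j, C i j * C k j) / 2 := by
    rw [Matrix.mul_apply, Fintype.sum_prod_type, Finset.mul_sum, ← Finset.sum_add_distrib,
      Finset.sum_div]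
    refine Finset.sum_congr rfl fun j _ => ?_
    simp only [Fin.sum_univ_two, Matrix.transpose_apply, hA]
    have h0 : sgn2 0 = 1 := by simp [sgn2]
    have h1 : sgn2 1 = -1 := by simp [sgn2]
    rw [h0, h1]
    ring
  rw [hs, hc, sum_offD_mul]
  by_cases hik : i = k
  · subst hik
    fin_cases a <;> fin_cases b <;> simp [sgn2, matJ, matK, Matrix.one_apply]
  · simp [hik, matJ, matK, Matrix.one_apply]
    ring

theorem sq_off {n : ℕ} (C : Matrix (Fin n) (Fin n) ℝ)
    (hent : ∀ i j, C i j = 0 ∨ C i j = 1 ∨ C i j = -1)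
    (hdiag : ∀ i, C i i = 0)
    (hconf : C * Cᵀ = ((n : ℝ) - 1) • (1 : Matrix (Fin n) (Fin n) ℝ)) (i j : Fin n) :
    C i j * C i j = offD i j := by
  have hc : ∑ j, C i j * C i j = ∑ j, offD i j := by
    have := congrFun (congrFun hconf i) i
    rw [sum_offD]
    simpa [Matrix.mul_apply, Matrix.one_apply] using this
  have hle : ∀ j ∈ Finset.univ, C i j * C i j ≤ offD i j := by
    intro j _
    unfold offD
    split_ifs with h
    · subst h; simp [hdiag]
    · rcases hent i j with h | h | h <;> rw [h] <;> norm_num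
  exact (Finset.sum_eq_sum_iff_of_le hle).1 hc j (Finset.mem_univ _)

theorem stmt14 (n : ℕ) (hn : 4 ≤ n) (hev : Even n)
    (C : Matrix (Fin n) (Fin n) ℝ)
    (hent : ∀ i j, C i j = 0 ∨ C i j = 1 ∨ C i j = -1)
    (hdiag : ∀ i, C i i = 0)
    (hconf : C * Cᵀ = ((n : ℝ) - 1) • (1 : Matrix (Fin n) (Fin n) ℝ))
    (A : Matrix (Fin n × Fin 2) (Fin n × Fin 2) ℝ)
    (hA : A = Matrix.of fun p q =>
      if (C p.1 q.1 = 1 ∧ p.2 = q.2) ∨ (C p.1 q.1 = -1 ∧ p.2 ≠ q.2) then 1 else 0) :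
    Is01 A ∧
    A * Aᵀ = ((n : ℝ) - 1) • (1 : Matrix (Fin n × Fin 2) (Fin n × Fin 2) ℝ)
      + ((n : ℝ) / 2 - 1) • (matJ (Fin n × Fin 2) - matK n 2) ∧
    Aᵀ * A = ((n : ℝ) - 1) • (1 : Matrix (Fin n × Fin 2) (Fin n × Fin 2) ℝ)
      + ((n : ℝ) / 2 - 1) • (matJ (Fin n × Fin 2) - matK n 2) ∧
    Is01 (A + matK n 2) ∧
    A * matK n 2 = matJ (Fin n × Fin 2) - matK n 2 ∧
    matK n 2 * A = matJ (Fin n × Fin 2) - matK n 2 := by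
  have hsq := sq_off C hent hdiag hconf
  have hA' : ∀ p q, A p q = (offD p.1 q.1 + sgn2 p.2 * sgn2 q.2 * C p.1 q.1) / 2 := by
    rintro ⟨i, a⟩ ⟨j, b⟩
    rw [hA, ← hsq]
    simp only [Matrix.of_apply]
    rcases hent i j with h | h | h <;> rw [h] <;> fin_cases a <;> fin_cases b <;>
      norm_num [sgn2]
  have hn0 : (n : ℝ) - 1 ≠ 0 := by
    have : (4 : ℝ) ≤ n := by exact_mod_cast hn
    linarith
  have hconf' : Cᵀ * (Cᵀ)ᵀ = ((n : ℝ) - 1) • (1 : Matrix (Fin n) (Fin n) ℝ) := by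
    have h1 : C * (((n : ℝ) - 1)⁻¹ • Cᵀ) = 1 := by
      rw [Matrix.mul_smul, hconf, smul_smul, inv_mul_cancel₀ hn0, one_smul]
    have h2 := mul_eq_one_comm.1 h1
    rw [Matrix.smul_mul] at h2
    rw [Matrix.transpose_transpose, ← h2, smul_smul, mul_inv_cancel₀ hn0, one_smul]
  have h01 : Is01 A := by
    intro p q
    rw [hA]
    simp only [Matrix.of_apply]
    split_ifs
    · exact Or.inr rfl
    · exact Or.inl rfl
  refine ⟨h01, core_mul C hconf A hA', ?_, ?_, ?_, ?_⟩
  · have := core_mul Cᵀ hconf' Aᵀ (by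
      intro p q
      rw [Matrix.transpose_apply, Matrix.transpose_apply, hA']
      simp only [offD, eq_comm]
      ring)
    rwa [Matrix.transpose_transpose] at this
  · intro p q
    by_cases h : p.1 = q.1
    · right
      simp [hA', matK, offD, h, hdiag]
    · simpa [matK, h] using h01 p q
  · ext ⟨i, a⟩ ⟨k, b⟩
    rw [Matrix.mul_apply, Fintype.sum_prod_type, Finset.sum_eq_single k]
    · simp only [hA', Fin.sum_univ_two, matK, matJ, sgn2, offD, Matrix.of_apply, Matrix.sub_apply]
      by_cases h : i = k
      · subst h; simp [hdiag]
      · simp [h]; split_ifs <;> ring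
    · intro j _ hj
      simp [matK, hj]
    · simp
  · ext ⟨i, a⟩ ⟨k, b⟩
    rw [Matrix.mul_apply, Fintype.sum_prod_type, Finset.sum_eq_single i]
    · simp only [hA', Fin.sum_univ_two, matK, matJ, sgn2, offD, Matrix.of_apply, Matrix.sub_apply]
      by_cases h : i = k
      · subst h; simp [hdiag]
      · simp [h]; split_ifs <;> ring
    · intro j _ hj
      simp [matK, hj.symm]
    · simp
end

section
/- Let G be a finite group with |G| = g ≥ 2, let λ ≥ 1, and set N = gλ+2. Let c be a function from {1,…,N}×{1,…,N} to G ∪ {0} such that c(i,j) = 0 if and only if i = j, and such that for all distinct i,h ∈ {1,…,N} and every y ∈ G, the number of indices j with c(i,j) ≠ 0, c(h,j) ≠ 0 and c(i,j)·c(h,j)⁻¹ = y equals λ, and likewise for all distinct i,h and every y ∈ G the number of indices j with c(j,i) ≠ 0, c(j,h) ≠ 0 and c(j,h)⁻¹·c(j,i) = y equals λ. Define the (0,1)-matrix M, with rows and columns indexed by {1,…,N}×G, by M((i,a),(j,b)) = 1 if c(i,j) ≠ 0 and a = c(i,j)·b, and 0 otherwise. Then, with K the block-diagonal matrix K((i,a),(j,b))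 = 1 iff i = j: M·Mᵀ = Mᵀ·M = (gλ+1)·I + λ·(J − K) (so M is an SGDD with parameters (g(gλ+2), gλ+1, gλ+2, g, 0, λ)); M + K is a (0,1)-matrix; and M·K = K·M = J − K. -/
open Matrix

attribute [local instance] Classical.propDecidable

theorem inner_row {G : Type*} [Group G] [Fintype G] (u v : Option G) (a b : G) :
    (∑ d : G, (if ∃ x : G, u = some x ∧ a = x * d then (1:ℝ) else 0) *
      (if ∃ x : G, v = some x ∧ b = x * d then (1:ℝ) else 0)) =
    if ∃ x y : G, u = some x ∧ v = some y ∧ x * y⁻¹ = a * b⁻¹ then 1 else 0 := by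
  rcases u with _ | x
  · simp
  rcases v with _ | y
  · simp
  have e : ∀ d : G, (a = x * d) ↔ (d = x⁻¹ * a) := fun d => by
    rw [eq_inv_mul_iff_mul_eq, eq_comm]
  simp only [Option.some.injEq, exists_eq_left', e, ite_mul, one_mul, zero_mul,
    Finset.sum_ite_eq', Finset.sum_ite_eq, Finset.mem_univ, if_true]
  congr 1
  apply propext
  rw [iff_comm]
  simp only [↓existsAndEq, true_and]
  constructor
  · intro h
    have h2 : x = a * b⁻¹ * y := mul_inv_eq_iff_eq_mul.mp h
    subst h2; group
  · rintro rfl; group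

theorem inner_col {G : Type*} [Group G] [Fintype G] (u v : Option G) (a b : G) :
    (∑ d : G, (if ∃ x : G, u = some x ∧ d = x * a then (1:ℝ) else 0) *
      (if ∃ x : G, v = some x ∧ d = x * b then (1:ℝ) else 0)) =
    if ∃ x y : G, u = some x ∧ v = some y ∧ y⁻¹ * x = b * a⁻¹ then 1 else 0 := by
  rcases u with _ | x
  · simp
  rcases v with _ | y
  · simp
  simp only [Option.some.injEq, exists_eq_left', ite_mul, one_mul, zero_mul,
    Finset.sum_ite_eq', Finset.sum_ite_eq, Finset.mem_univ, if_true]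
  congr 1
  apply propext
  simp only [↓existsAndEq, true_and]
  rw [eq_mul_inv_iff_mul_eq, mul_assoc, inv_mul_eq_iff_eq_mul]

theorem sum_ind {n : ℕ} (P : Fin n → Prop) [DecidablePred P] :
    (∑ j, if P j then (1:ℝ) else 0) = (Nat.card {j // P j} : ℝ) := by
  rw [Finset.sum_boole, Nat.card_eq_fintype_card, Fintype.card_subtype]

theorem sum_ne {n : ℕ} (i : Fin (n + 1)) (Q : Prop) :
    (∑ j, if j ≠ i ∧ Q then (1:ℝ) else 0) = if Q then (n : ℝ) else 0 := by
  by_cases hQ : Q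
  · simp only [hQ, and_true, if_true]
    rw [Finset.sum_boole, Finset.filter_ne', Finset.card_erase_of_mem (Finset.mem_univ _)]
    simp
  · simp [hQ]

theorem stmt15 (G : Type*) [Group G] [Fintype G] (g lam : ℕ)
    (hg : Fintype.card G = g) (hg2 : 2 ≤ g) (hlam : 1 ≤ lam)
    (c : Fin (g * lam + 2) → Fin (g * lam + 2) → Option G)
    (hc0 : ∀ i j, c i j = none ↔ i = j)
    (hrow : ∀ i h : Fin (g * lam + 2), i ≠ h → ∀ y : G,
      Nat.card {j : Fin (g * lam + 2) //
        ∃ a b : G, c i j = some a ∧ c h j = some b ∧ a * b⁻¹ = y} = lam)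
    (hcol : ∀ i h : Fin (g * lam + 2), i ≠ h → ∀ y : G,
      Nat.card {j : Fin (g * lam + 2) //
        ∃ a b : G, c j i = some a ∧ c j h = some b ∧ b⁻¹ * a = y} = lam)
    (M : Matrix (Fin (g * lam + 2) × G) (Fin (g * lam + 2) × G) ℝ)
    (hM : M = Matrix.of fun p q =>
      if ∃ x : G, c p.1 q.1 = some x ∧ p.2 = x * q.2 then 1 else 0)
    (K : Matrix (Fin (g * lam + 2) × G) (Fin (g * lam + 2) × G) ℝ)
    (hK : K = Matrix.of fun p q => if p.1 = q.1 then 1 else 0) :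
    M * Mᵀ = ((g : ℝ) * lam + 1) • (1 : Matrix (Fin (g * lam + 2) × G) (Fin (g * lam + 2) × G) ℝ)
      + (lam : ℝ) • (matJ (Fin (g * lam + 2) × G) - K) ∧
    Mᵀ * M = ((g : ℝ) * lam + 1) • (1 : Matrix (Fin (g * lam + 2) × G) (Fin (g * lam + 2) × G) ℝ)
      + (lam : ℝ) • (matJ (Fin (g * lam + 2) × G) - K) ∧
    Is01 (M + K) ∧
    M * K = matJ (Fin (g * lam + 2) × G) - K ∧
    K * M = matJ (Fin (g * lam + 2) × G) - K := by
  have hex : ∀ i j, i ≠ j → ∃ x, c i j = some x := fun i j hij =>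
    Option.ne_none_iff_exists'.mp (fun h => hij ((hc0 i j).mp h))
  have hd : ∀ i, c i i = none := fun i => (hc0 i i).mpr rfl
  subst hM hK
  refine ⟨?_, ?_, ?_, ?_, ?_⟩
  · ext ⟨i, a⟩ ⟨h, b⟩
    simp only [Matrix.mul_apply, Matrix.transpose_apply, Matrix.of_apply, Fintype.sum_prod_type,
      Matrix.add_apply, Matrix.smul_apply, Matrix.sub_apply, matJ, Matrix.one_apply,
      Prod.mk.injEq, smul_eq_mul]
    refine (Finset.sum_congr rfl (fun j _ => (by convert inner_row (c i j) (c h j) a b : _ = _))).trans ?_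
    by_cases hih : i = h
    · subst hih
      have e : ∀ j, (∃ x y : G, c i j = some x ∧ c i j = some y ∧ x * y⁻¹ = a * b⁻¹) ↔
          (j ≠ i ∧ a = b) := by
        intro j
        by_cases hj : j = i
        · subst hj; simp [hd]
        · obtain ⟨x, hx⟩ := hex i j (Ne.symm hj)
          simp [hx, hj, eq_comm, mul_inv_eq_one]
      simp only [e]
      rw [sum_ne]
      simp
    · rw [sum_ind, hrow i h hih]
      simp [hih]
  · ext ⟨i, a⟩ ⟨h, b⟩
    simp only [Matrix.mul_apply, Matrix.transpose_apply, Matrix.of_apply, Fintype.sum_prod_type,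
      Matrix.add_apply, Matrix.smul_apply, Matrix.sub_apply, matJ, Matrix.one_apply,
      Prod.mk.injEq, smul_eq_mul]
    refine (Finset.sum_congr rfl (fun j _ => (by convert inner_col (c j i) (c j h) a b : _ = _))).trans ?_
    by_cases hih : i = h
    · subst hih
      have e : ∀ j, (∃ x y : G, c j i = some x ∧ c j i = some y ∧ y⁻¹ * x = b * a⁻¹) ↔
          (j ≠ i ∧ a = b) := by
        intro j
        by_cases hj : j = i
        · subst hj; simp [hd]
        · obtain ⟨x, hx⟩ := hex j i hj
          simp only [hx, Option.some.injEq, ↓existsAndEq, inv_mul_cancel, ne_eq, hj,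
            not_false_eq_true, true_and]
          rw [eq_comm, mul_inv_eq_one, eq_comm]
      simp only [e]
      rw [sum_ne]
      simp
    · rw [sum_ind, hcol i h hih]
      simp [hih]
  · rintro ⟨i, a⟩ ⟨h, b⟩
    simp only [Matrix.add_apply, Matrix.of_apply]
    by_cases hih : i = h
    · subst hih; simp [hd]
    · simp only [hih, if_false, add_zero]
      split_ifs <;> simp
  · ext ⟨i, a⟩ ⟨h, b⟩
    simp only [Matrix.mul_apply, Matrix.of_apply, Fintype.sum_prod_type_right, Matrix.sub_apply,
      matJ, mul_ite, mul_one, mul_zero, Finset.sum_ite_eq', Finset.sum_ite_eq, Finset.mem_univ,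
      if_true]
    by_cases hih : i = h
    · subst hih; simp [hd]
    · obtain ⟨x, hx⟩ := hex i h hih
      have e : ∀ d : G, (a = x * d) ↔ (d = x⁻¹ * a) := fun d => by
        rw [eq_inv_mul_iff_mul_eq, eq_comm]
      simp [hx, hih, e]
  · ext ⟨i, a⟩ ⟨h, b⟩
    simp only [Matrix.mul_apply, Matrix.of_apply, Fintype.sum_prod_type_right, Matrix.sub_apply,
      matJ, ite_mul, one_mul, zero_mul, Finset.sum_ite_eq', Finset.sum_ite_eq, Finset.mem_univ,
      if_true]
    by_cases hih : i = h
    · subst hih; simp [hd]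
    · obtain ⟨x, hx⟩ := hex i h hih
      simp [hx, hih]
end

section
/- Let v,k,r,λ,μ be positive integers, let C_1,…,C_r be auxiliary matrices with parameters (v,k,r,λ,μ) such that none of C_1,…,C_r equals the all-ones matrix J_v, and set C_0 = O_v (the v×v zero matrix). Let L be a Latin square of size r+1 on the symbol set {0,1,…,r}. Define the (r+1)v × (r+1)v block matrix M whose (a,b)-block is C_{L(a,b)} for a,b ∈ {0,1,…,r}. Then M·Mᵀ = Mᵀ·M = (kr − kλ)·I_{(r+1)v} + kλ·J_{(r+1)v}; i.e., M is the incidence matrix of a symmetric 2-((r+1)v, kr, kλ) design. -/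
open Matrix

theorem half_aux (v k r lam mu : ℕ)
    (D : Fin (r + 1) → Matrix (Fin v) (Fin v) ℝ)
    (h1 : ∀ x y, ∑ i, ∑ z, D i x z * D i y z =
      ((k : ℝ) * r - (k : ℝ) * lam) * (if x = y then 1 else 0) + (k : ℝ) * lam)
    (h2 : ∀ i j, i ≠ j → ∀ x y, ∑ z, D i x z * D j y z =
      (mu : ℝ) * (1 - (if i = 0 then 1 else 0) - (if j = 0 then 1 else 0)))
    (h3 : ((r : ℝ) - 1) * mu = k * lam)
    (L : Fin (r + 1) → Fin (r + 1) → Fin (r + 1))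
    (hL : IsLatinSquare L)
    (M : Matrix (Fin (r + 1) × Fin v) (Fin (r + 1) × Fin v) ℝ)
    (hM : M = Matrix.of fun p q => D (L p.1 q.1) p.2 q.2) :
    M * Mᵀ = ((k : ℝ) * r - (k : ℝ) * lam) •
        (1 : Matrix (Fin (r + 1) × Fin v) (Fin (r + 1) × Fin v) ℝ)
      + ((k : ℝ) * lam) • matJ (Fin (r + 1) × Fin v) := by
  ext ⟨a, x⟩ ⟨b, y⟩
  subst hM
  simp only [Matrix.mul_apply, Matrix.transpose_apply, Matrix.of_apply, Fintype.sum_prod_type,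
    Matrix.add_apply, Matrix.smul_apply, matJ, smul_eq_mul, mul_one, Matrix.one_apply,
    Prod.mk.injEq]
  by_cases hab : a = b
  · subst hab
    rw [(hL.1 a).sum_comp (fun i => ∑ z, D i x z * D i y z), h1]
    simp
  · have hne : ∀ c, L a c ≠ L b c := fun c h => hab ((hL.2 c).1 h)
    rw [Finset.sum_congr rfl (fun c _ => h2 _ _ (hne c) x y), ← Finset.mul_sum,
      Finset.sum_sub_distrib, Finset.sum_sub_distrib,
      (hL.1 a).sum_comp (fun i => if i = 0 then (1 : ℝ) else 0),
      (hL.1 b).sum_comp (fun i => if i = 0 then (1 : ℝ) else 0)]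
    simp [hab]
    linarith

theorem stmt17 (v k r lam mu : ℕ) (hv : 0 < v) (hk : 0 < k) (hr : 0 < r)
    (hlam : 0 < lam) (hmu : 0 < mu)
    (C : Fin r → Matrix (Fin v) (Fin v) ℝ)
    (hC : IsAuxiliary C k lam mu)
    (hJ : ∀ i, C i ≠ matJ (Fin v))
    (D : Fin (r + 1) → Matrix (Fin v) (Fin v) ℝ)
    (hD0 : D 0 = 0) (hDs : ∀ i : Fin r, D i.succ = C i)
    (L : Fin (r + 1) → Fin (r + 1) → Fin (r + 1))
    (hL : IsLatinSquare L)
    (M : Matrix (Fin (r + 1) × Fin v) (Fin (r + 1) × Fin v) ℝ)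
    (hM : M = Matrix.of fun p q => D (L p.1 q.1) p.2 q.2) :
    M * Mᵀ = ((k : ℝ) * r - (k : ℝ) * lam) •
        (1 : Matrix (Fin (r + 1) × Fin v) (Fin (r + 1) × Fin v) ℝ)
      + ((k : ℝ) * lam) • matJ (Fin (r + 1) × Fin v) ∧
    Mᵀ * M = ((k : ℝ) * r - (k : ℝ) * lam) •
        (1 : Matrix (Fin (r + 1) × Fin v) (Fin (r + 1) × Fin v) ℝ)
      + ((k : ℝ) * lam) • matJ (Fin (r + 1) × Fin v) := by
  obtain ⟨h01, hsum, hsq, hmul⟩ := hC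
  have hk0 : (k : ℝ) ≠ 0 := by exact_mod_cast hk.ne'
  have hsym : ∀ i, (C i)ᵀ = C i := by
    intro i
    have h := congrArg Matrix.transpose (hsq i)
    rw [Matrix.transpose_mul, Matrix.transpose_transpose, hsq i, Matrix.transpose_smul] at h
    exact (smul_right_injective _ hk0 h).symm
  have hle : ∀ i x y, C i x y ≤ 1 := by
    intro i x y
    rcases h01 i x y with h | h <;> rw [h] <;> norm_num
  have hdiag : ∀ i x, C i x x = 1 := by
    intro i x
    have h := congrFun (congrFun hsum x) x
    simp [Matrix.sum_apply, matJ] at h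
    have h' : ∑ i, C i x x = ∑ i : Fin r, (1 : ℝ) := by simp [h]
    exact (Finset.sum_eq_sum_iff_of_le (fun i _ => hle i x x)).1 h' i (Finset.mem_univ _)
  have hrow : ∀ i x, ∑ y, C i x y = k := by
    intro i x
    have h := congrFun (congrFun (hsq i) x) x
    simp only [Matrix.mul_apply, Matrix.transpose_apply, Matrix.smul_apply, hdiag, smul_eq_mul,
      mul_one] at h
    rw [← h]
    refine Finset.sum_congr rfl fun y _ => ?_
    rcases h01 i x y with h | h <;> rw [h] <;> norm_num
  have h3 : ((r : ℝ) - 1) * mu = k * lam := by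
    let i0 : Fin r := ⟨0, hr⟩
    obtain ⟨x, y, hxy⟩ : ∃ x y, C i0 x y = 0 := by
      by_contra! hcon
      apply hJ i0
      ext x y
      exact (h01 i0 x y).resolve_left (hcon x y)
    have e1 : C i0 * ∑ j, C j = (k : ℝ) • C i0 + (((r : ℝ) - 1) * mu) • matJ (Fin v) := by
      rw [Finset.mul_sum, ← Finset.add_sum_erase _ _ (Finset.mem_univ i0)]
      congr 1
      · rw [← hsq i0, hsym]
      · rw [Finset.sum_congr rfl (g := fun _ => (mu : ℝ) • matJ (Fin v))]
        · rw [Finset.sum_const, Finset.card_erase_of_mem (Finset.mem_univ _), Finset.card_univ,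
            Fintype.card_fin, ← Nat.cast_smul_eq_nsmul ℝ, smul_smul, Nat.cast_sub hr]
          simp
        · intro j hj
          rw [← hmul i0 j (Finset.ne_of_mem_erase hj).symm, hsym]
    rw [hsum] at e1
    have h := congrFun (congrFun e1 x) y
    rw [mul_add, Matrix.mul_smul, Matrix.mul_smul, mul_one] at h
    simp only [Matrix.add_apply, Matrix.smul_apply, hxy, Matrix.mul_apply, matJ, Matrix.of_apply,
      smul_eq_mul, mul_one, mul_zero, zero_add, hrow] at h
    linarith
  have h1 : ∀ x y, ∑ i, ∑ z, D i x z * D i y z =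
      ((k : ℝ) * r - (k : ℝ) * lam) * (if x = y then 1 else 0) + (k : ℝ) * lam := by
    intro x y
    have h := congrFun (congrFun hsum x) y
    simp only [Matrix.sum_apply, Matrix.add_apply, Matrix.smul_apply, matJ, Matrix.of_apply,
      smul_eq_mul, mul_one, Matrix.one_apply] at h
    have e : ∀ i, ∑ z, C i x z * C i y z = k * C i x y := fun i =>
      congrFun (congrFun (hsq i) x) y
    rw [Fin.sum_univ_succ]
    simp only [hD0, hDs, e, ← Finset.mul_sum, h]
    split_ifs
    · simp
    · simp
  have h2 : ∀ i j, i ≠ j → ∀ x y, ∑ z, D i x z * D j y z =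
      (mu : ℝ) * (1 - (if i = 0 then 1 else 0) - (if j = 0 then 1 else 0)) := by
    intro i j hij x y
    induction i using Fin.cases with
    | zero => simp [hD0, hij.symm]
    | succ i =>
      induction j using Fin.cases with
      | zero => simp [hD0]
      | succ j =>
        have h := congrFun (congrFun (hmul i j (fun h => hij (by rw [h]))) x) y
        simp only [Matrix.mul_apply, Matrix.transpose_apply, Matrix.smul_apply, matJ,
          Matrix.of_apply, smul_eq_mul] at h
        simp [hDs, h]
  have hDsym : ∀ i x y, D i x y = D i y x := by
    intro i x y
    induction i using Fin.cases with
    | zero => simp [hD0]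
    | succ i =>
      rw [hDs]
      exact congrFun (congrFun (hsym i) y) x
  refine ⟨half_aux v k r lam mu D h1 h2 h3 L hL M hM, ?_⟩
  have h := half_aux v k r lam mu D h1 h2 h3 (fun i j => L j i) ⟨hL.2, hL.1⟩ Mᵀ (by
    ext p q
    rw [hM]
    exact hDsym _ _ _)
  rwa [Matrix.transpose_transpose] at h
end

section
/- Let v,k,r,λ,μ be positive integers, let C_1,…,C_r be auxiliary matrices with parameters (v,k,r,λ,μ), and set C_0 = O_v. Let f ≥ 3 and let L_{i,j} (i,j ∈ {1,…,f}, i ≠ j) be linked MOLS of size r+1 on the symbol set {0,1,…,r}, each having all diagonal entries equal to 0. For each pair i ≠ j define the (r+1)v × (r+1)v block matrix A_{i,j} whose (a,b)-block is C_{L_{i,j}(a,b)} for a,b ∈ {0,1,…,r}. Then for all mutually distinct i,j,l one has A_{i,j}·A_{j,l} = k·A_{i,l} + 2μ·(I_{r+1} ⊗ J_v) + (r−2)·μ·J_{(r+1)v}. -/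
open Matrix

theorem stmt18 (v k r lam mu f : ℕ) (hv : 0 < v) (hk : 0 < k) (hr : 0 < r)
    (hlam : 0 < lam) (hmu : 0 < mu) (hf : 3 ≤ f)
    (C : Fin r → Matrix (Fin v) (Fin v) ℝ)
    (hC : IsAuxiliary C k lam mu)
    (D : Fin (r + 1) → Matrix (Fin v) (Fin v) ℝ)
    (hD0 : D 0 = 0) (hDs : ∀ i : Fin r, D i.succ = C i)
    (L : Fin f → Fin f → (Fin (r + 1) → Fin (r + 1) → Fin (r + 1)))
    (hLatin : ∀ i j, i ≠ j → IsLatinSquare (L i j))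
    (hdiag : ∀ i j, i ≠ j → ∀ a, L i j a a = 0)
    (hlinked : ∀ i j l, i ≠ j → j ≠ l → i ≠ l →
      (∀ a b, ∃! e, L i l a e = L j l b e) ∧
      (∀ a b e, L i l a e = L j l b e → L i j a b = L i l a e))
    (A : Fin f → Fin f → Matrix (Fin (r + 1) × Fin v) (Fin (r + 1) × Fin v) ℝ)
    (hA : ∀ i j, i ≠ j → A i j = Matrix.of fun p q => D (L i j p.1 q.1) p.2 q.2) :
    ∀ i j l, i ≠ j → j ≠ l → i ≠ l →
      A i j * A j l = (k : ℝ) • A i l + (2 * (mu : ℝ)) • matK (r + 1) v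
        + (((r : ℝ) - 2) * (mu : ℝ)) • matJ (Fin (r + 1) × Fin v) := by
  obtain ⟨_, _, hkk, hmm⟩ := hC
  have hkR : (k : ℝ) ≠ 0 := by exact_mod_cast hk.ne'
  have hDD : ∀ s, D s * (D s)ᵀ = (k : ℝ) • D s := by
    intro s
    refine Fin.cases ?_ (fun t => ?_) s
    · simp [hD0]
    · rw [hDs]; exact hkk t
  have hsym : ∀ s, (D s)ᵀ = D s := by
    intro s
    have h2 : (D s * (D s)ᵀ)ᵀ = D s * (D s)ᵀ := by simp
    rw [hDD, Matrix.transpose_smul] at h2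
    exact smul_right_injective _ hkR h2
  have hDne : ∀ s t, s ≠ t → s ≠ 0 → t ≠ 0 → D s * D t = (mu : ℝ) • matJ (Fin v) := by
    intro s t hst hs ht
    obtain ⟨s1, rfl⟩ := Fin.exists_succ_eq.mpr hs
    obtain ⟨t1, rfl⟩ := Fin.exists_succ_eq.mpr ht
    rw [← hsym t1.succ, hDs, hDs]
    exact hmm _ _ (fun h => hst (by rw [h]))
  have hDsq : ∀ s, D s * D s = (k : ℝ) • D s := by
    intro s
    have := hDD s
    rwa [hsym] at this
  intro i j l hij hjl hil
  have htr : ∀ e b, L j l e b = L l j b e := by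
    intro e b
    obtain ⟨e0, he0, -⟩ := (hlinked j l i hjl hil.symm hij.symm).1 e b
    rw [(hlinked j l i hjl hil.symm hij.symm).2 e b e0 he0,
      (hlinked l j i hjl.symm hij.symm hil.symm).2 b e e0 he0.symm, he0]
  have hz : ∀ i j, i ≠ j → ∀ a e, L i j a e = 0 → e = a := by
    intro i j hij a e h
    exact ((hLatin i j hij).1 a).1 (h.trans (hdiag i j hij a).symm)
  rw [hA i j hij, hA j l hjl, hA i l hil]
  ext ⟨a, x⟩ ⟨b, y⟩
  obtain ⟨e0, he0, huniq⟩ := (hlinked i l j hil hjl.symm hij).1 a b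
  have hval := (hlinked i l j hil hjl.symm hij).2 a b e0 he0
  have key : ∀ e, (∑ z, D (L i j a e) x z * D (L j l e b) z y) =
      (if e = e0 then (k : ℝ) * D (L i l a b) x y else 0) + (mu : ℝ) *
        (1 - (if e = e0 then 1 else 0) - (if e = a then 1 else 0) - (if e = b then 1 else 0)
          + 2 * (if a = b then (if e = a then 1 else 0) else 0)) := by
    intro e
    rw [htr, ← Matrix.mul_apply]
    by_cases h0 : e = e0
    · subst h0
      rw [← he0, hDsq, ← hval]
      by_cases ha : e = a
      · have hb : e = b := by
          apply hz l j hjl.symm b e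
          rw [← he0, ha]; exact hdiag i j hij a
        have hab : a = b := ha.symm.trans hb
        simp only [ha, hab, if_true, Matrix.smul_apply, smul_eq_mul]; ring
      · have hb : e ≠ b := by
          intro hb
          apply ha
          apply hz i j hij a e
          rw [he0, hb]; exact hdiag l j hjl.symm b
        simp [ha, hb]
    · have hne : L i j a e ≠ L l j b e := fun h => h0 (huniq e h)
      by_cases ha : e = a
      · have hb : e ≠ b := by
          intro hb
          apply hne
          rw [← ha, ← hb, hdiag i j hij, hdiag l j hjl.symm]
        have hab : a ≠ b := ha ▸ hb
        subst ha
        simp [hdiag i j hij, hD0, h0, hab]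
      · by_cases hb : e = b
        · subst hb
          simp [hdiag l j hjl.symm, hD0, h0, ha]
        · rw [hDne _ _ hne (fun h => ha (hz i j hij a e h))
            (fun h => hb (hz l j hjl.symm b e h))]
          simp [h0, ha, hb, matJ]
  simp only [Matrix.mul_apply, Matrix.of_apply, Fintype.sum_prod_type, key, Matrix.add_apply,
    Matrix.smul_apply, matK, matJ, smul_eq_mul]
  rw [Finset.sum_add_distrib, ← Finset.mul_sum]
  simp only [Finset.sum_add_distrib, Finset.sum_sub_distrib, ← Finset.mul_sum]
  by_cases hab : a = b
  · simp [hab]; ring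
  · simp [hab]; ring
end
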